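/- There exists a constant c > 0 such that for every finite simple graph G and every maximal matching M of G, every execution of the algorithm MaxMatch under the adversarial distributed daemon is finite and contains at most c·n³ moves in total (so MaxMatch converges in O(n³) moves and is silent). -/

import Mathlib

open Classical

section MaxMatchPreamble

variable {V : Type*} [Fintype V] [LinearOrder V]

/-- Strict comparison on identifiers where `none` (null) counts as greater
than every identifier. -/
def optLT : Option V → Option V → Prop
  | some x, some y => x < y
  | some _, none => True
  | none, _ => False

/-- A configuration of the MaxMatch algorithm: the variables `p`, `α`, `β`
(`a`,`b` here) and the booleans `s`, `end` (`e` here) of every vertex. -/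
structure MMConfig (V : Type*) where
  p : V → Option V
  a : V → Option V
  b : V → Option V
  s : V → Bool
  e : V → Bool

/-- The local state of one vertex. -/
structure MMLocal (V : Type*) where
  p : Option V
  a : Option V
  b : Option V
  s : Bool
  e : Bool

/-- The local state of vertex `u` in configuration `C`. -/
def MMConfig.loc (C : MMConfig V) (u : V) : MMLocal V :=
  ⟨C.p u, C.a u, C.b u, C.s u, C.e u⟩

/-- `m` encodes a maximal matching of `G`: `m u = some v` iff `(u,v)` is a
matching edge, `m u = none` iff `u` is single. -/
structure MaxMatchingOn (G : SimpleGraph V) (m : V → Option V) : Prop where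
  adj : ∀ u v, m u = some v → G.Adj u v
  symm : ∀ u v, m u = some v → m v = some u
  maximal : ∀ u v, G.Adj u v → m u ≠ none ∨ m v ≠ none

/-- `Lowest(S)`: the minimum-identifier element of `S`, `none` if `S = ∅`. -/
noncomputable def lowestSet (S : Set V) : Option V :=
  if h : (Finset.univ.filter fun x => x ∈ S).Nonempty
  then some ((Finset.univ.filter fun x => x ∈ S).min' h) else none

/-- `Lowest` of a finite set of identifiers-or-null: `none` (null) elements are
greater than all identifiers, hence ignored. -/
noncomputable def lowestOpt (S : Finset (Option V)) : Option V :=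
  lowestSet {x : V | some x ∈ S}

/-- Truth value of a proposition. -/
noncomputable def pb (P : Prop) : Bool := if P then true else false

variable (G : SimpleGraph V) (m : V → Option V)

/-- The candidate set considered by `BestRematch(u)`. -/
def candSet (C : MMConfig V) (u : V) : Set V :=
  {x | G.Adj u x ∧ m x = none ∧ (C.p x = some u ∨ C.e x = false)}

/-- `BestRematch(u)`. -/
noncomputable def bestRematch (C : MMConfig V) (u : V) : Option V × Option V :=
  let a := lowestSet (candSet G m C u)
  (a, a.elim none fun w => lowestSet (candSet G m C u \ {w}))

/-- `AskFirst(u)`. -/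
noncomputable def askFirst (C : MMConfig V) (u : V) : Option V :=
  match m u with
  | none => none
  | some v =>
      if C.a u ≠ none ∧ C.a v ≠ none ∧
         2 ≤ ({C.a u, C.b u, C.a v, C.b v} : Finset (Option V)).card ∧
         (optLT (C.a u) (C.a v) ∨ (C.a u = C.a v ∧ C.b u = none) ∨
          (C.a u = C.a v ∧ C.b v ≠ none ∧ u < v))
      then C.a u else none

/-- `AskSecond(u)`. -/
noncomputable def askSecond (C : MMConfig V) (u : V) : Option V :=
  match m u with
  | none => none
  | some v =>
      if askFirst m C v ≠ none
      then lowestOpt (({C.a u, C.b u} : Finset (Option V)) \ {C.a v})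
      else none

/-- `Ask(u)`. -/
noncomputable def ask (C : MMConfig V) (u : V) : Option V :=
  if askFirst m C u = none then askSecond m C u else askFirst m C u

/-- Guard of rule `ResetEnd` (single vertices). -/
def guardResetEnd (C : MMConfig V) (x : V) : Prop :=
  C.p x = none ∧ C.e x = true

/-- Guard of rule `UpdateP` (single vertices). -/
def guardUpdateP (C : MMConfig V) (x : V) : Prop :=
  (C.p x = none ∧ ∃ w, G.Adj x w ∧ m w ≠ none ∧ C.p w = some x) ∨
  (∃ w, C.p x = some w ∧ ¬ (G.Adj x w ∧ m w ≠ none)) ∨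
  (∃ w, C.p x = some w ∧ C.p w ≠ some x)

/-- Guard of rule `UpdateEnd` (single vertices). -/
def guardUpdateEnd (C : MMConfig V) (x : V) : Prop :=
  ∃ w, C.p x = some w ∧ G.Adj x w ∧ m w ≠ none ∧ C.p w = some x ∧ C.e x ≠ C.e w

/-- `o ∈ single(N(u)) ∪ {null}`. -/
def inSNopt (u : V) (o : Option V) : Prop :=
  o = none ∨ ∃ w, o = some w ∧ G.Adj u w ∧ m w = none

/-- First part (first four disjuncts) of the guard of rule `Update`. -/
def guardUpdateA (C : MMConfig V) (u : V) : Prop :=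
  optLT (C.b u) (C.a u) ∨
  (¬ inSNopt G m u (C.a u) ∨ ¬ inSNopt G m u (C.b u)) ∨
  (C.a u = C.b u ∧ C.a u ≠ none) ∨
  ¬ inSNopt G m u (C.p u)

/-- Guard of rule `Update` (matched vertices). -/
def guardUpdate (C : MMConfig V) (u : V) : Prop :=
  guardUpdateA G m C u ∨
  ((C.a u, C.b u) ≠ bestRematch G m C u ∧
    (C.p u = none ∨ ∃ w, C.p u = some w ∧ C.p w ≠ some u ∧ C.e w = true))

/-- `p_{p_u} = u`. -/
def ppEq (C : MMConfig V) (u : V) : Prop :=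
  ∃ w, C.p u = some w ∧ C.p w = some u

/-- Value assigned to `s_u` by `MatchFirst` (`v = m_u`). -/
def mfS (C : MMConfig V) (u v : V) : Prop :=
  C.p u = askFirst m C u ∧ ppEq C u ∧ (C.p v = askSecond m C v ∨ C.p v = none)

/-- Value assigned to `end_u` by `MatchFirst` (`v = m_u`). -/
def mfE (C : MMConfig V) (u v : V) : Prop :=
  C.p u = askFirst m C u ∧ ppEq C u ∧ C.s u = true ∧
  C.p v = askSecond m C v ∧ C.e v = true

/-- Guard of rule `MatchFirst` (matched vertices). -/
def guardMatchFirst (C : MMConfig V) (u : V) : Prop :=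
  askFirst m C u ≠ none ∧ ∃ v, m u = some v ∧
    (C.p u ≠ askFirst m C u ∨ ¬ (C.s u = true ↔ mfS m C u v) ∨
     ¬ (C.e u = true ↔ mfE m C u v))

/-- Value assigned to `end_u` (and then `s_u`) by `MatchSecond` (`v = m_u`). -/
def msE (C : MMConfig V) (u v : V) : Prop :=
  C.p u = askSecond m C u ∧ ppEq C u ∧ C.p v = askFirst m C v

/-- Guard of rule `MatchSecond` (matched vertices). -/
def guardMatchSecond (C : MMConfig V) (u : V) : Prop :=
  askSecond m C u ≠ none ∧ ∃ v, m u = some v ∧ C.s v = true ∧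
    (C.p u ≠ askSecond m C u ∨ ¬ (C.e u = true ↔ msE m C u v) ∨ C.s u ≠ C.e u)

/-- Guard of rule `ResetMatch` (matched vertices). -/
def guardResetMatch (C : MMConfig V) (u : V) : Prop :=
  (askFirst m C u = none ∧ askSecond m C u = none ∧
    ¬ (C.p u = none ∧ C.s u = false ∧ C.e u = false)) ∨
  (askSecond m C u ≠ none ∧ C.p u ≠ none ∧ ∃ v, m u = some v ∧ C.s v = false)

/-- The local state of `u` after it atomically executes the command of its
highest-priority true-guard rule (its state is unchanged if no guard holds). -/
noncomputable def localNext (C : MMConfig V) (u : V) : MMLocal V :=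
  if m u = none then
    if guardResetEnd C u then ⟨C.p u, C.a u, C.b u, C.s u, false⟩
    else if guardUpdateP G m C u then
      ⟨lowestSet {w | G.Adj u w ∧ C.p w = some u}, C.a u, C.b u, C.s u, false⟩
    else if guardUpdateEnd G m C u then
      ⟨C.p u, C.a u, C.b u, C.s u, (C.p u).elim (C.e u) C.e⟩
    else C.loc u
  else
    if guardUpdate G m C u then
      ⟨none, (bestRematch G m C u).1, (bestRematch G m C u).2, false, false⟩
    else if guardMatchFirst m C u then
      ⟨askFirst m C u, C.a u, C.b u,
        pb (∃ v, m u = some v ∧ mfS m C u v),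
        pb (∃ v, m u = some v ∧ mfE m C u v)⟩
    else if guardMatchSecond m C u then
      ⟨askSecond m C u, C.a u, C.b u,
        pb (∃ v, m u = some v ∧ msE m C u v),
        pb (∃ v, m u = some v ∧ msE m C u v)⟩
    else if guardResetMatch m C u then ⟨none, C.a u, C.b u, false, false⟩
    else C.loc u

/-- `u` is activable (eligible for some rule) in `C`. -/
def Activable (C : MMConfig V) (u : V) : Prop :=
  (m u = none ∧ (guardResetEnd C u ∨ guardUpdateP G m C u ∨ guardUpdateEnd G m C u)) ∨
  (m u ≠ none ∧ (guardUpdate G m C u ∨ guardMatchFirst m C u ∨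
    guardMatchSecond m C u ∨ guardResetMatch m C u))

/-- A configuration is stable when no vertex is activable. -/
def Stable (C : MMConfig V) : Prop := ∀ u, ¬ Activable G m C u

/-- One transition of the adversarial distributed daemon: the nonempty set `A`
of activable vertices simultaneously execute their (highest-priority) rules. -/
def StepOn (C C' : MMConfig V) (A : Set V) : Prop :=
  A.Nonempty ∧ (∀ u ∈ A, Activable G m C u) ∧
  (∀ u ∈ A, C'.loc u = localNext G m C u) ∧
  (∀ u, u ∉ A → C'.loc u = C.loc u)

/-- A (maximal) execution, padded with stuttering once a stable configuration is
reached: at each index either a genuine transition occurs, or the configuration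
is stable and nothing moves.  `u ∈ act i` means `u` makes a move in transition
`i ↦ i+1`. -/
structure MMExecution (G : SimpleGraph V) (m : V → Option V) where
  cfg : ℕ → MMConfig V
  act : ℕ → Set V
  valid : ∀ i, StepOn G m (cfg i) (cfg (i+1)) (act i) ∨
    (act i = ∅ ∧ Stable G m (cfg i) ∧ cfg (i+1) = cfg i)

/-- μ: the number of matched vertices. -/
noncomputable def muV : ℕ := (Finset.univ.filter fun u : V => m u ≠ none).card

/-- σ: the number of single vertices. -/
noncomputable def sigmaV : ℕ := (Finset.univ.filter fun u : V => m u = none).card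

/-- The matching `M` as a relation. -/
def Mrel (a b : V) : Prop := m a = some b

/-- The output edge set `M⁺` of a configuration, as a relation. -/
def Mplus (C : MMConfig V) (a b : V) : Prop :=
  (m a = some b ∧ C.p a = none ∧ C.p b = none) ∨
  (G.Adj a b ∧ m a ≠ some b ∧ C.p a = some b ∧ C.p b = some a)

/-- `(x,u,v,y)` is a 3-augmenting path on `(G, M')`. -/
def IsAug3 (M' : V → V → Prop) (x u v y : V) : Prop :=
  x ≠ u ∧ x ≠ v ∧ x ≠ y ∧ u ≠ v ∧ u ≠ y ∧ v ≠ y ∧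
  G.Adj x u ∧ G.Adj u v ∧ G.Adj v y ∧
  M' u v ∧ ¬ M' x u ∧ ¬ M' v y

end MaxMatchPreamble


/-- Potential of a matched edge `u, v` where only `u` is first. -/
def normalPot (pu su eu py pn sv ev : Bool) : ℕ :=
  bif pu then
    bif py || pn then
      bif su then
        8 + (bif py then (bif sv && ev then 2 else 1) else 0) +
          (bif eu then (bif py && ev then 2 else 0) else 1)
      else 5 + (!eu).toNat + (pn && !sv && !ev).toNat
    else 3 + (!su && !eu).toNat
  else
    bif py || pn then
      1 + (bif su then (py && !sv && !ev).toNat else (pn && !sv && !ev).toNat)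
    else 0

theorem normalPot_le (pu su eu py pn sv ev : Bool) : normalPot pu su eu py pn sv ev ≤ 12 := by
  revert pu su eu py pn sv ev; decide

/-- A move of a first vertex; `B` says that its partner's pointer is admissible, and `D` that the
partner has ended. -/
def FirstMove (pu su eu B D pp pu' su' eu' : Bool) : Prop :=
  ((su || eu) = true → pp = true) ∧
  (pu = false ∨ su ≠ (pu && pp && B) ∨ eu ≠ (pu && pp && su && D)) ∧
  pu' = true ∧ su' = (pu && pp && B) ∧ eu' = (pu && pp && su && D)

/-- A move of a second vertex. -/
def SecondMove (py pn sv ev pu su pp py' pn' sv' ev' : Bool) : Prop :=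
  ((sv || ev) = true → pp = true) ∧ (py && pn) = false ∧
  ((su = true ∧ (py = false ∨ ev ≠ (py && pp && pu) ∨ sv ≠ ev) ∧
      py' = true ∧ pn' = false ∧ sv' = (py && pp && pu) ∧ ev' = (py && pp && pu)) ∨
    (su = false ∧ pn = false ∧ py' = false ∧ pn' = true ∧ sv' = false ∧ ev' = false))

set_option synthInstance.maxSize 1000 in
set_option synthInstance.maxHeartbeats 400000 in
theorem normalPot_lt {pu su eu py pn sv ev ppu ppv pu' su' eu' py' pn' sv' ev' : Bool}
    (hu : pu' = pu ∧ su' = su ∧ eu' = eu ∨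
      FirstMove pu su eu (py || pn) (py && ev) ppu pu' su' eu')
    (hv : py' = py ∧ pn' = pn ∧ sv' = sv ∧ ev' = ev ∨
      SecondMove py pn sv ev pu su ppv py' pn' sv' ev')
    (h : FirstMove pu su eu (py || pn) (py && ev) ppu pu' su' eu' ∨
      SecondMove py pn sv ev pu su ppv py' pn' sv' ev') :
    normalPot pu su eu py pn sv ev < normalPot pu' su' eu' py' pn' sv' ev' := by
  have hu' : FirstMove pu su eu (py || pn) (py && ev) ppu pu' su' eu' →
     normalPot pu su eu py pn sv ev < normalPot pu' su' eu' py' pn' sv' ev' := by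
    rintro ⟨h1, h2, rfl, rfl, rfl⟩
    rcases hv with ⟨rfl, rfl, rfl, rfl⟩ | ⟨h3, h4, ⟨rfl, h5, rfl, rfl, rfl, rfl⟩ | ⟨rfl, rfl, rfl, rfl, rfl, rfl⟩⟩
    · clear h hu; revert pu su eu py' pn' sv' ev' ppu; decide
    · clear h hu; revert pu eu py pn sv ev ppu ppv; decide
    · clear h hu; revert pu eu py sv ev ppu ppv; decide
  rcases hu with ⟨rfl, rfl, rfl⟩ | hu
  · rcases h with h | ⟨h3, h4, ⟨rfl, h5, rfl, rfl, rfl, rfl⟩ | ⟨rfl, rfl, rfl, rfl, rfl, rfl⟩⟩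
    · exact hu' h
    · clear hu' hv ppu; revert pu' eu' py pn sv ev ppv; decide
    · clear hu' hv ppu; revert pu' eu' py sv ev ppv; decide
  · exact hu' hu

/-- Potential of a first vertex while its partner does not move. -/
def firstPot (pu su eu B D : Bool) : ℕ :=
  bif pu then
    bif B then (bif su then 3 + (eu == D).toNat else 1 + (!eu).toNat)
    else 1 + (!su && !eu).toNat
  else 0

/-- Potential of a matched edge whose two endpoints are both first. -/
def bothPot (pu su eu nu pv sv ev nv : Bool) : ℕ :=
  bif pu then
    bif pv then 6 + (!su && !eu).toNat + (!sv && !ev).toNat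
    else 1 + firstPot pu su eu nv (nv && ev)
  else
    bif pv then 1 + firstPot pv sv ev nu (nu && eu) else 0

theorem bothPot_le (pu su eu nu pv sv ev nv : Bool) : bothPot pu su eu nu pv sv ev nv ≤ 12 := by
  revert pu su eu nu pv sv ev nv; decide

set_option synthInstance.maxSize 1000 in
set_option synthInstance.maxHeartbeats 400000 in
set_option maxRecDepth 10000 in
theorem bothPot_lt {pu su eu nu pv sv ev nv ppu ppv pu' su' eu' nu' pv' sv' ev' nv' : Bool}
    (du : (pu && nu) = false) (dv : (pv && nv) = false)
    (hu : (pu' = pu ∧ su' = su ∧ eu' = eu ∧ nu' = nu) ∨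
      (FirstMove pu su eu nv (nv && ev) ppu pu' su' eu' ∧ nu' = false))
    (hv : (pv' = pv ∧ sv' = sv ∧ ev' = ev ∧ nv' = nv) ∨
      (FirstMove pv sv ev nu (nu && eu) ppv pv' sv' ev' ∧ nv' = false))
    (h : FirstMove pu su eu nv (nv && ev) ppu pu' su' eu' ∧ nu' = false ∨
      FirstMove pv sv ev nu (nu && eu) ppv pv' sv' ev' ∧ nv' = false) :
    bothPot pu su eu nu pv sv ev nv < bothPot pu' su' eu' nu' pv' sv' ev' nv' := by
  have hu' : FirstMove pu su eu nv (nv && ev) ppu pu' su' eu' ∧ nu' = false →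
      bothPot pu su eu nu pv sv ev nv < bothPot pu' su' eu' nu' pv' sv' ev' nv' := by
    rintro ⟨⟨h1, h2, rfl, rfl, rfl⟩, rfl⟩
    rcases hv with ⟨rfl, rfl, rfl, rfl⟩ | ⟨⟨h3, h4, rfl, rfl, rfl⟩, rfl⟩
    · clear h hu; revert pu su eu nu pv' sv' ev' nv' ppu; decide
    · clear h hu; revert pu su eu nu pv sv ev nv ppu ppv; decide
  rcases hu with ⟨rfl, rfl, rfl, rfl⟩ | hu
  · rcases h with h | ⟨⟨h3, h4, rfl, rfl, rfl⟩, rfl⟩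
    · exact hu' h
    · clear hu' hv ppu; revert pu' su' eu' nu' pv sv ev nv ppv; decide
  · exact hu' hu

/-- Potential of a matched edge none of whose endpoints is first. -/
def restPot (du dv : Bool) : ℕ := du.toNat + dv.toNat

/-- The number of `i < N` satisfying `P`. -/
noncomputable def cnt (P : ℕ → Prop) (N : ℕ) : ℕ := ((Finset.range N).filter P).card

theorem cnt_succ (P : ℕ → Prop) (N : ℕ) : cnt P (N + 1) = cnt P N + if P N then 1 else 0 := by
  unfold cnt
  rw [Finset.range_add_one, Finset.filter_insert]
  split_ifs <;> simp

theorem cnt_zero (P : ℕ → Prop) : cnt P 0 = 0 := by simp [cnt]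

theorem cnt_le_cnt {P Q : ℕ → Prop} (h : ∀ i, P i → Q i) (N : ℕ) : cnt P N ≤ cnt Q N :=
  Finset.card_le_card fun i hi => by
    simp only [Finset.mem_filter] at hi ⊢
    exact ⟨hi.1, h i hi.2⟩

theorem cnt_mono (P : ℕ → Prop) {N N' : ℕ} (h : N ≤ N') : cnt P N ≤ cnt P N' :=
  Finset.card_le_card (Finset.filter_subset_filter _ (Finset.range_mono h))

theorem cnt_lt {P : ℕ → Prop} {i N : ℕ} (hi : P i) (h : i < N) : cnt P i < cnt P N := by
  have h1 := cnt_mono P (Nat.succ_le_of_lt h)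
  rw [Nat.succ_eq_add_one, cnt_succ, if_pos hi] at h1
  omega

theorem cnt_or {P Q R : ℕ → Prop} (h : ∀ i, P i → Q i ∨ R i) (N : ℕ) :
    cnt P N ≤ cnt Q N + cnt R N := by
  refine le_trans (Finset.card_le_card ?_) (Finset.card_union_le _ _)
  intro i hi
  simp only [Finset.mem_filter, Finset.mem_union] at hi ⊢
  rcases h i hi.2 with h | h
  · exact Or.inl ⟨hi.1, h⟩
  · exact Or.inr ⟨hi.1, h⟩

theorem cnt_exists {ι : Type*} [Fintype ι] {P : ℕ → Prop} {Q : ι → ℕ → Prop}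
    (h : ∀ i, P i → ∃ x, Q x i) (N : ℕ) : cnt P N ≤ ∑ x, cnt (Q x) N := by
  refine le_trans (Finset.card_le_card ?_) Finset.card_biUnion_le
  intro i hi
  simp only [Finset.mem_filter, Finset.mem_biUnion, Finset.mem_univ, true_and] at hi ⊢
  obtain ⟨x, hx⟩ := h i hi.2
  exact ⟨x, hi.1, hx⟩

theorem exists_last_or_cnt_eq_zero (P : ℕ → Prop) (N : ℕ) :
    cnt P N = 0 ∨ ∃ i < N, P i ∧ (∀ k, i < k → k < N → ¬ P k) ∧ cnt P N = cnt P i + 1 := by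
  induction N with
  | zero => exact Or.inl (cnt_zero P)
  | succ N ih =>
    by_cases hP : P N
    · refine Or.inr ⟨N, Nat.lt_succ_self N, hP, fun k h1 h2 => by omega, ?_⟩
      rw [cnt_succ, if_pos hP]
    · rw [cnt_succ, if_neg hP, add_zero]
      refine ih.imp_right ?_
      rintro ⟨i, hi, h1, h2, h3⟩
      refine ⟨i, by omega, h1, fun k hk hk' => ?_, h3⟩
      rcases Nat.lt_succ_iff_lt_or_eq.1 hk' with h | rfl
      · exact h2 k hk h
      · exact hP

/-- If some `Q` occurs between any two consecutive occurrences of `P`, then `P` occurs at most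
once more than `Q`. -/
theorem cnt_le_of_between {P Q : ℕ → Prop}
    (h : ∀ i j, i < j → P i → P j → (∀ k, i < k → k < j → ¬ P k) → ∃ t, i ≤ t ∧ t < j ∧ Q t)
    (N : ℕ) : cnt P N ≤ cnt Q N + 1 := by
  have key : ∀ j, P j → cnt P j ≤ cnt Q j := by
    intro j
    induction j using Nat.strong_induction_on with
    | _ j ih =>
      intro hj
      rcases exists_last_or_cnt_eq_zero P j with h0 | ⟨i, hi, h1, h2, h3⟩
      · omega
      · obtain ⟨t, ht1, ht2, ht⟩ := h i j hi h1 hj h2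
        have := cnt_lt ht ht2
        have := cnt_mono Q ht1
        have := ih i hi h1
        omega
  rcases exists_last_or_cnt_eq_zero P N with h0 | ⟨i, hi, h1, -, h3⟩
  · omega
  · have := key i h1
    have := cnt_mono Q hi.le
    omega

theorem cnt_le_one {P : ℕ → Prop} (h : ∀ i j, i < j → P i → P j → False) (N : ℕ) :
    cnt P N ≤ 1 := by
  have := cnt_le_of_between (P := P) (Q := fun _ => False)
    (fun i j hij hi hj _ => (h i j hij hi hj).elim) N
  simpa [cnt] using this

/-- If a potential bounded by `K` never decreases and increases at each occurrence of `P`, except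
when `Q` occurs, then the occurrences of `P` are bounded in terms of those of `Q`. -/
theorem cnt_le_of_potential {P Q : ℕ → Prop} {f : ℕ → ℕ} {K : ℕ} (hf : ∀ i, f i ≤ K)
    (h : ∀ i, ¬ Q i → f i ≤ f (i + 1) ∧ (P i → f i < f (i + 1))) (N : ℕ) :
    cnt P N ≤ (K + 1) * cnt Q N + K := by
  suffices cnt P N ≤ (K + 1) * cnt Q N + f N from this.trans (Nat.add_le_add_left (hf N) _)
  induction N with
  | zero => simp [cnt_zero]
  | succ N ih =>
    rw [cnt_succ, cnt_succ]
    have hN := hf N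
    by_cases hQ : Q N
    · rw [if_pos hQ, mul_add, mul_one]
      split_ifs <;> omega
    · obtain ⟨h1, h2⟩ := h N hQ
      rw [if_neg hQ, add_zero]
      split_ifs with hP
      · have := h2 hP
        omega
      · omega

theorem lowestSet_eq_some {V : Type*} [Fintype V] [LinearOrder V] {S : Set V} {x : V}
    (h : lowestSet S = some x) : x ∈ S ∧ ∀ y ∈ S, x ≤ y := by
  unfold lowestSet at h
  split_ifs at h with hS
  rw [Option.some.injEq] at h
  subst h
  have := Finset.min'_mem _ hS
  refine ⟨by simpa using this, fun y hy => Finset.min'_le _ _ (by simpa using hy)⟩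

theorem lowestSet_eq_none {V : Type*} [Fintype V] [LinearOrder V] {S : Set V}  :
    lowestSet S = none ↔ S = ∅ := by
  unfold lowestSet
  split_ifs with hS
  · obtain ⟨x, hx⟩ := hS
    simp only [false_iff]
    rintro rfl
    simp at hx
  · simp only [true_iff]
    ext x
    simp only [Set.mem_empty_iff_false, iff_false]
    exact fun hx => hS ⟨x, by simpa using hx⟩

set_option linter.unusedSectionVars false

section Asks

variable {V : Type*} [Fintype V] [LinearOrder V] {G : SimpleGraph V} {m : V → Option V}
  {C C' : MMConfig V} {u v : V}

/-- The condition under which `u`, with partner `v`, is first. -/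
def FirstCond (C : MMConfig V) (u v : V) : Prop :=
  C.a u ≠ none ∧ C.a v ≠ none ∧
    2 ≤ ({C.a u, C.b u, C.a v, C.b v} : Finset (Option V)).card ∧
    (optLT (C.a u) (C.a v) ∨ (C.a u = C.a v ∧ C.b u = none) ∨
      (C.a u = C.a v ∧ C.b v ≠ none ∧ u < v))

theorem askFirst_eq (hu : m u = some v) :
    askFirst m C u = if FirstCond C u v then C.a u else none := by
  simp only [askFirst, hu, FirstCond]
  congr

theorem askFirst_ne_none (hu : m u = some v) : askFirst m C u ≠ none ↔ FirstCond C u v := by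
  rw [askFirst_eq hu]
  split_ifs with h
  · exact ⟨fun _ => h, fun _ => h.1⟩
  · simp [h]

theorem askFirst_of_ne_none (hu : m u = some v) (h : askFirst m C u ≠ none) :
    askFirst m C u = C.a u := by
  rw [askFirst_eq hu, if_pos ((askFirst_ne_none hu).1 h)]

theorem askSecond_eq (hu : m u = some v) : askSecond m C u =
    if askFirst m C v ≠ none then lowestOpt (({C.a u, C.b u} : Finset (Option V)) \ {C.a v})
    else none := by
  simp only [askSecond, hu]

theorem FirstCond.both (h : FirstCond C u v) (h' : FirstCond C v u) :
    C.a u = C.a v ∧ C.b u = none ∧ C.b v = none := by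
  obtain ⟨h1, h2, -, h3⟩ := h
  obtain ⟨-, -, -, h4⟩ := h'
  cases hau : C.a u with
  | none => exact (h1 hau).elim
  | some x =>
    cases hav : C.a v with
    | none => exact (h2 hav).elim
    | some y =>
      simp only [hau, hav, optLT, Option.some.injEq] at h3 h4 ⊢
      grind

theorem lowestOpt_eq_some {S : Finset (Option V)} {x : V} (h : lowestOpt S = some x) :
    some x ∈ S := (lowestSet_eq_some h).1

theorem lowestOpt_ne_none {S : Finset (Option V)} {o : Option V} (ho : o ≠ none) (h : o ∈ S) :
    lowestOpt S ≠ none := by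
  obtain ⟨x, rfl⟩ := Option.ne_none_iff_exists'.1 ho
  intro h0
  have h1 := lowestSet_eq_none.1 h0
  have h2 : x ∈ ({x : V | some x ∈ S} : Set V) := h
  rw [h1] at h2
  exact h2

theorem askSecond_eq_some {y : V} (hu : m u = some v) (h : askSecond m C u = some y) :
    C.a u = some y ∨ C.b u = some y := by
  rw [askSecond_eq hu] at h
  split_ifs at h
  have := lowestOpt_eq_some h
  simp only [Finset.mem_sdiff, Finset.mem_insert, Finset.mem_singleton] at this
  exact this.1.imp Eq.symm Eq.symm

/-- A first vertex is not second. -/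
theorem askSecond_eq_none_of_askFirst (hu : m u = some v) (hv : m v = some u)
    (h : askFirst m C u ≠ none) : askSecond m C u = none := by
  rw [askSecond_eq hu]
  split_ifs with h'
  · have hb := ((askFirst_ne_none hu).1 h).both ((askFirst_ne_none hv).1 h')
    by_contra hne
    obtain ⟨x, hx⟩ := Option.ne_none_iff_exists'.1 hne
    have := lowestOpt_eq_some hx
    simp [hb.1, hb.2.1] at this
  · rfl

theorem askFirst_eq_none_of_askSecond (hu : m u = some v) (hv : m v = some u)
    (h : askSecond m C u ≠ none) : askFirst m C u = none := by
  by_contra h'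
  exact h (askSecond_eq_none_of_askFirst hu hv h')

theorem askSecond_ne_none (hu : m u = some v) (hv : m v = some u)
    (hA : ¬ guardUpdateA G m C v) (h : askFirst m C u ≠ none) (h' : askFirst m C v = none) :
    askSecond m C v ≠ none := by
  rw [askSecond_eq hv, if_pos h]
  have hF := (askFirst_ne_none hu).1 h
  obtain ⟨h1, h2, h3, h4⟩ := hF
  have hn : ¬ FirstCond C v u := fun hc => (askFirst_ne_none hv).2 hc h'
  by_cases he : C.a u = C.a v
  · have hb : C.b v ≠ none := by
      intro hb
      refine hn ⟨h2, h1, ?_, Or.inr (Or.inl ⟨he.symm, hb⟩)⟩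
      convert h3 using 2
      ext o
      simp only [Finset.mem_insert, Finset.mem_singleton]
      tauto
    refine lowestOpt_ne_none hb ?_
    simp only [guardUpdateA, not_or, not_and, not_not] at hA
    simp only [Finset.mem_sdiff, Finset.mem_insert, Finset.mem_singleton, or_true, true_and]
    intro hba
    exact h2 (hA.2.2.1 (by rw [hba, he]))
  · refine lowestOpt_ne_none h2 ?_
    simpa using fun h => he h.symm

theorem askFirst_congr (hu : m u = some v) (h1 : C'.a u = C.a u) (h2 : C'.b u = C.b u)
    (h3 : C'.a v = C.a v) (h4 : C'.b v = C.b v) : askFirst m C' u = askFirst m C u := by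
  have h : FirstCond C' u v ↔ FirstCond C u v := by simp only [FirstCond, h1, h2, h3, h4]
  simp only [askFirst_eq hu, h, h1]

theorem askSecond_congr (hu : m u = some v) (hv : m v = some u) (h1 : C'.a u = C.a u)
    (h2 : C'.b u = C.b u) (h3 : C'.a v = C.a v) (h4 : C'.b v = C.b v) :
    askSecond m C' u = askSecond m C u := by
  rw [askSecond_eq hu, askSecond_eq hu, askFirst_congr hv h3 h4 h1 h2, h1, h2, h3]

end Asks

section Steps

variable {V : Type*} [Fintype V] [LinearOrder V] {G : SimpleGraph V} {m : V → Option V}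
  {C C' : MMConfig V} {A : Set V} {u v x : V}

/-- The transition `C ↦ C'` in which exactly the vertices of `A` move. -/
def LocalStep (G : SimpleGraph V) (m : V → Option V) (C C' : MMConfig V) (A : Set V) : Prop :=
  ∀ u, (u ∈ A ∧ Activable G m C u ∧ C'.loc u = localNext G m C u) ∨
    (u ∉ A ∧ C'.loc u = C.loc u)

theorem MMExecution.localStep (E : MMExecution G m) (i : ℕ) :
    LocalStep G m (E.cfg i) (E.cfg (i + 1)) (E.act i) := by
  intro u
  rcases E.valid i with ⟨-, h1, h2, h3⟩ | ⟨h1, -, h3⟩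
  · by_cases hu : u ∈ E.act i
    · exact Or.inl ⟨hu, h1 u hu, h2 u hu⟩
    · exact Or.inr ⟨hu, h3 u hu⟩
  · exact Or.inr ⟨by simp [h1], by rw [h3]⟩

/-- What a single vertex may do in one transition. -/
inductive SingleStep (G : SimpleGraph V) (m : V → Option V) (C C' : MMConfig V) (A : Set V)
    (x : V) : Prop
  | idle (hA : x ∉ A) (hp : C'.p x = C.p x) (he : C'.e x = C.e x)
  | resetEnd (hA : x ∈ A) (hp0 : C.p x = none) (he0 : C.e x = true) (hp : C'.p x = C.p x)
      (he : C'.e x = false)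
  | updateP (hA : x ∈ A) (hg : guardUpdateP G m C x)
      (hp : C'.p x = lowestSet {w | G.Adj x w ∧ C.p w = some x}) (he : C'.e x = false)
  | updateEnd (hA : x ∈ A) (w : V) (hw : C.p x = some w) (hadj : G.Adj x w) (hm : m w ≠ none)
      (hpw : C.p w = some x) (hne : C.e x ≠ C.e w) (hp : C'.p x = C.p x) (he : C'.e x = C.e w)

theorem LocalStep.single (h : LocalStep G m C C' A) (hx : m x = none) :
    SingleStep G m C C' A x := by
  rcases h x with ⟨hA, hact, hl⟩ | ⟨hA, hl⟩
  · simp only [Activable, hx, true_and, ne_eq, not_true_eq_false, false_and, or_false] at hact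
    simp only [localNext, hx, if_true, MMConfig.loc] at hl
    split_ifs at hl with h1 h2 h3
    · simp only [MMLocal.mk.injEq] at hl
      exact .resetEnd hA h1.1 h1.2 hl.1 hl.2.2.2.2
    · simp only [MMLocal.mk.injEq] at hl
      exact .updateP hA h2 hl.1 hl.2.2.2.2
    · simp only [MMLocal.mk.injEq] at hl
      obtain ⟨w, hw, hadj, hm, hpw, hne⟩ := h3
      refine .updateEnd hA w hw hadj hm hpw hne hl.1 ?_
      rw [hl.2.2.2.2, hw]
      rfl
    · tauto
  · simp only [MMConfig.loc, MMLocal.mk.injEq] at hl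
    exact .idle hA hl.1 hl.2.2.2.2

/-- What a matched vertex `u` with partner `v` may do in one transition. -/
inductive MatchedStep (G : SimpleGraph V) (m : V → Option V) (C C' : MMConfig V) (A : Set V)
    (u v : V) : Prop
  | idle (hA : u ∉ A) (ha : C'.a u = C.a u) (hb : C'.b u = C.b u) (hp : C'.p u = C.p u)
      (hs : C'.s u = C.s u) (he : C'.e u = C.e u)
  | update (hA : u ∈ A) (hg : guardUpdate G m C u) (ha : C'.a u = (bestRematch G m C u).1)
      (hb : C'.b u = (bestRematch G m C u).2) (hp : C'.p u = none)
      (hs : C'.s u = false) (he : C'.e u = false)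
  | matchFirst (hA : u ∈ A) (hg : ¬ guardUpdate G m C u) (hf : askFirst m C u ≠ none)
      (hc : C.p u ≠ askFirst m C u ∨ C.s u ≠ decide (mfS m C u v) ∨
        C.e u ≠ decide (mfE m C u v))
      (ha : C'.a u = C.a u) (hb : C'.b u = C.b u)
      (hp : C'.p u = askFirst m C u) (hs : C'.s u = decide (mfS m C u v))
      (he : C'.e u = decide (mfE m C u v))
  | matchSecond (hA : u ∈ A) (hg : ¬ guardUpdate G m C u) (hf : askSecond m C u ≠ none)
      (hsv : C.s v = true)
      (hc : C.p u ≠ askSecond m C u ∨ C.e u ≠ decide (msE m C u v) ∨ C.s u ≠ C.e u)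
      (ha : C'.a u = C.a u) (hb : C'.b u = C.b u)
      (hp : C'.p u = askSecond m C u) (hs : C'.s u = decide (msE m C u v))
      (he : C'.e u = decide (msE m C u v))
  | resetMatch (hA : u ∈ A) (hg : ¬ guardUpdate G m C u) (hf : askFirst m C u = none)
      (hc : (askSecond m C u = none ∧ ¬ (C.p u = none ∧ C.s u = false ∧ C.e u = false)) ∨
        (askSecond m C u ≠ none ∧ C.p u ≠ none ∧ C.s v = false))
      (ha : C'.a u = C.a u) (hb : C'.b u = C.b u)
      (hp : C'.p u = none) (hs : C'.s u = false) (he : C'.e u = false)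

theorem pb_eq_decide (P : Prop) : pb P = decide P := by
  unfold pb
  split_ifs with h <;> simp [h]

theorem not_iff_iff_ne_decide (b : Bool) (P : Prop) : ¬ (b = true ↔ P) ↔ b ≠ decide P := by
  by_cases hP : P <;> simp [hP]

theorem LocalStep.matched (h : LocalStep G m C C' A) (hu : m u = some v) (hv : m v = some u) :
    MatchedStep G m C C' A u v := by
  rcases h u with ⟨hA, hact, hl⟩ | ⟨hA, hl⟩
  · simp only [Activable, hu, reduceCtorEq, false_and, false_or, ne_eq, not_false_eq_true,
      true_and] at hact
    simp only [localNext, hu, reduceCtorEq, if_false, MMConfig.loc, Option.some.injEq,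
      exists_eq_left', pb_eq_decide] at hl
    split_ifs at hl with h1 h2 h3 h4
    · simp only [MMLocal.mk.injEq] at hl
      obtain ⟨hp, ha, hb, hs, he⟩ := hl
      exact .update hA h1 ha hb hp hs he
    · simp only [MMLocal.mk.injEq] at hl
      obtain ⟨hp, ha, hb, hs, he⟩ := hl
      obtain ⟨hf, w, hw, hc⟩ := h2
      obtain rfl : v = w := by simpa [hu] using hw
      simp only [not_iff_iff_ne_decide] at hc
      exact .matchFirst hA h1 hf hc ha hb hp hs he
    · simp only [MMLocal.mk.injEq] at hl
      obtain ⟨hp, ha, hb, hs, he⟩ := hl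
      obtain ⟨hf, w, hw, hsw, hc⟩ := h3
      obtain rfl : v = w := by simpa [hu] using hw
      simp only [not_iff_iff_ne_decide] at hc
      exact .matchSecond hA h1 hf hsw hc ha hb hp hs he
    · simp only [MMLocal.mk.injEq] at hl
      obtain ⟨hp, ha, hb, hs, he⟩ := hl
      rcases h4 with ⟨hf, hc⟩ | ⟨hf, hc, w, hw, hsw⟩
      · exact .resetMatch hA h1 hf (Or.inl hc) ha hb hp hs he
      · obtain rfl : v = w := by simpa [hu] using hw
        exact .resetMatch hA h1 (askFirst_eq_none_of_askSecond hu hv hf)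
          (Or.inr ⟨hf, hc, hsw⟩) ha hb hp hs he
    · tauto
  · simp only [MMConfig.loc, MMLocal.mk.injEq] at hl
    obtain ⟨hp, ha, hb, hs, he⟩ := hl
    exact .idle hA ha hb hp hs he

theorem MatchedStep.bestRematch_admissible (C : MMConfig V) (u : V) :
    ¬ optLT (bestRematch G m C u).2 (bestRematch G m C u).1 ∧
    inSNopt G m u (bestRematch G m C u).1 ∧ inSNopt G m u (bestRematch G m C u).2 ∧
    ((bestRematch G m C u).1 = (bestRematch G m C u).2 → (bestRematch G m C u).1 = none) := by
  simp only [bestRematch]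
  cases h1 : lowestSet (candSet G m C u) with
  | none => simp [inSNopt, optLT]
  | some w =>
    have hw := lowestSet_eq_some h1
    simp only [Option.elim_some]
    cases h2 : lowestSet (candSet G m C u \ {w}) with
    | none =>
      simp only [inSNopt, optLT]
      exact ⟨id, Or.inr ⟨w, rfl, hw.1.1, hw.1.2.1⟩, Or.inl trivial, fun h => nomatch h⟩
    | some z =>
      have hz := lowestSet_eq_some h2
      simp only [inSNopt, optLT, Option.some.injEq]
      refine ⟨not_lt.2 (hw.2 z hz.1.1), Or.inr ⟨w, rfl, hw.1.1, hw.1.2.1⟩,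
        Or.inr ⟨z, rfl, hz.1.1.1, hz.1.1.2.1⟩, fun h => (hz.1.2 h.symm).elim⟩

theorem not_guardUpdateA_iff : ¬ guardUpdateA G m C u ↔ ¬ optLT (C.b u) (C.a u) ∧
    inSNopt G m u (C.a u) ∧ inSNopt G m u (C.b u) ∧ (C.a u = C.b u → C.a u = none) ∧
    inSNopt G m u (C.p u) := by
  simp only [guardUpdateA, not_or, not_and, not_not, and_assoc]

theorem LocalStep.not_guardUpdateA (h : LocalStep G m C C' A) (hu : m u = some v)
    (hv : m v = some u) (h0 : u ∈ A ∨ ¬ guardUpdateA G m C u) : ¬ guardUpdateA G m C' u := by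
  have key : ¬ guardUpdate G m C u → C'.a u = C.a u → C'.b u = C.b u →
      (C'.p u = none ∨ C'.p u = C.a u ∨ C'.p u = C.b u) → ¬ guardUpdateA G m C' u := by
    intro hg ha hb hp
    have hA : ¬ guardUpdateA G m C u := fun h => hg (Or.inl h)
    rw [not_guardUpdateA_iff] at hA ⊢
    rw [ha, hb]
    refine ⟨hA.1, hA.2.1, hA.2.2.1, hA.2.2.2.1, ?_⟩
    rcases hp with hp | hp | hp <;> rw [hp]
    · exact Or.inl rfl
    · exact hA.2.1
    · exact hA.2.2.1
  cases h.matched hu hv with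
  | idle hA ha hb hp hs he =>
    have hA := h0.resolve_left hA
    rw [not_guardUpdateA_iff] at hA ⊢
    rwa [ha, hb, hp]
  | update hA hg ha hb hp hs he =>
    rw [not_guardUpdateA_iff, ha, hb, hp]
    obtain ⟨h1, h2, h3, h4⟩ := MatchedStep.bestRematch_admissible (G := G) (m := m) C u
    exact ⟨h1, h2, h3, h4, Or.inl rfl⟩
  | matchFirst hA hg hf hc ha hb hp hs he =>
    exact key hg ha hb (Or.inr (Or.inl (hp.trans (askFirst_of_ne_none hu hf))))
  | matchSecond hA hg hf hsv hc ha hb hp hs he =>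
    obtain ⟨y, hy⟩ := Option.ne_none_iff_exists'.1 hf
    refine key hg ha hb (Or.inr ?_)
    rw [hp, hy]
    exact (askSecond_eq_some hu hy).imp Eq.symm Eq.symm
  | resetMatch hA hg hf hc ha hb hp hs he => exact key hg ha hb (Or.inl hp)

theorem LocalStep.pointer_eq (h : LocalStep G m C C' A) (hx : m x = none) (hadj : G.Adj x u)
    (hu : m u ≠ none) (hp : C.p u = some x) (hpx : C.p x = some u) : C'.p x = some u := by
  cases h.single hx with
  | idle hA hp' he => rw [hp', hpx]
  | resetEnd hA hp0 he0 hp' he => rw [hp', hpx]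
  | updateP hA hg hp' he =>
    simp only [guardUpdateP, hpx] at hg
    simp_all
  | updateEnd hA w hw hadj hm hpw hne hp' he => rw [hp', hpx]

theorem LocalStep.ppEq_next (h : LocalStep G m C C' A) (hu : m u ≠ none)
    (hA : ¬ guardUpdateA G m C u) (hpp : ppEq C u) (hp : C'.p u = C.p u) : ppEq C' u := by
  obtain ⟨x, hx, hxu⟩ := hpp
  have hS := (not_guardUpdateA_iff.1 hA).2.2.2.2
  rcases hS with hS | ⟨w, hw, hadj, hm⟩
  · simp [hx] at hS
  · obtain rfl : x = w := by simpa [hx] using hw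
    exact ⟨x, by rw [hp, hx], h.pointer_eq hm hadj.symm hu hx hxu⟩

theorem not_guardUpdate (hA : ¬ guardUpdateA G m C u) (hpp : ppEq C u) :
    ¬ guardUpdate G m C u := by
  obtain ⟨x, hx, hxu⟩ := hpp
  rintro (h | ⟨-, h | ⟨w, hw, h1, -⟩⟩)
  · exact hA h
  · simp [hx] at h
  · obtain rfl : x = w := by simpa [hx] using hw
    exact h1 hxu

theorem LocalStep.mutual_of_true (h : LocalStep G m C C' A) (hu : m u = some v)
    (hv : m v = some u) (hA : u ∈ A) (ht : C'.s u = true ∨ C'.e u = true) :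
    C'.p u = C.p u ∧ ppEq C u ∧ ¬ guardUpdateA G m C u := by
  cases h.matched hu hv with
  | idle hA' => exact (hA' hA).elim
  | update hA hg ha hb hp hs he => simp [hs, he] at ht
  | matchFirst hA hg hf hc ha hb hp hs he =>
    simp only [hs, he, decide_eq_true_eq] at ht
    refine ⟨?_, ?_, fun h => hg (Or.inl h)⟩
    · rw [hp]
      exact ht.elim (fun h => h.1.symm) (fun h => h.1.symm)
    · exact ht.elim (fun h => h.2.1) (fun h => h.2.1)
  | matchSecond hA hg hf hsv hc ha hb hp hs he =>
    simp only [hs, he, decide_eq_true_eq, or_self] at ht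
    exact ⟨by rw [hp, ht.1], ht.2.1, fun h => hg (Or.inl h)⟩
  | resetMatch hA hg hf hc ha hb hp hs he => simp [hs, he] at ht

/-- The invariant enjoyed by a matched vertex once it has moved. -/
def Good (G : SimpleGraph V) (m : V → Option V) (C : MMConfig V) (u : V) : Prop :=
  ¬ guardUpdateA G m C u ∧ (C.s u = true ∨ C.e u = true → ppEq C u)

theorem LocalStep.good (h : LocalStep G m C C' A) (hu : m u = some v)
    (hv : m v = some u) (h0 : u ∈ A ∨ Good G m C u) : Good G m C' u := by
  refine ⟨h.not_guardUpdateA hu hv (h0.imp_right And.left), fun ht => ?_⟩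
  by_cases hA : u ∈ A
  · obtain ⟨h1, h2, h3⟩ := h.mutual_of_true hu hv hA ht
    exact h.ppEq_next (by simp [hu]) h3 h2 h1
  · have hG := h0.resolve_left hA
    cases h.matched hu hv with
    | idle hA' ha hb hp hs he =>
      rw [hs, he] at ht
      exact h.ppEq_next (by simp [hu]) hG.1 (hG.2 ht) hp
    | _ => contradiction

theorem LocalStep.first_hold (h : LocalStep G m C C' A) (hu : m u = some v) (hv : m v = some u)
    (hA : ¬ guardUpdateA G m C u) (hp : C.p u = askFirst m C u) (hpp : ppEq C u) :
    C'.a u = C.a u ∧ C'.b u = C.b u ∧ C'.p u = C.p u ∧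
    ((u ∉ A ∧ C'.s u = C.s u ∧ C'.e u = C.e u) ∨
      (u ∈ A ∧ C'.s u = decide (mfS m C u v) ∧ C'.e u = decide (mfE m C u v))) := by
  have hU := not_guardUpdate hA hpp
  have hf : askFirst m C u ≠ none := by
    obtain ⟨x, hx, -⟩ := hpp
    rw [← hp, hx]; simp
  cases h.matched hu hv with
  | idle hA ha hb hp' hs he => exact ⟨ha, hb, hp', Or.inl ⟨hA, hs, he⟩⟩
  | update hA hg ha hb hp hs he => contradiction
  | matchFirst hA hg hf hc ha hb hp' hs he =>
    exact ⟨ha, hb, hp'.trans hp.symm, Or.inr ⟨hA, hs, he⟩⟩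
  | matchSecond hA hg hf' => exact (hf' (askSecond_eq_none_of_askFirst hu hv hf)).elim
  | resetMatch hA hg hf' => contradiction

theorem LocalStep.second_hold (h : LocalStep G m C C' A) (hu : m u = some v) (hv : m v = some u)
    (hA : ¬ guardUpdateA G m C v) (hp : C.p v = askSecond m C v) (hpp : ppEq C v)
    (hs : C.s u = true) (hpu : C.p u = askFirst m C u) :
    C'.a v = C.a v ∧ C'.b v = C.b v ∧ C'.p v = C.p v ∧
      ((v ∉ A ∧ C'.e v = C.e v) ∨ (v ∈ A ∧ C'.e v = true)) := by
  have hU := not_guardUpdate hA hpp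
  have hf : askSecond m C v ≠ none := by
    obtain ⟨x, hx, -⟩ := hpp
    rw [← hp, hx]; simp
  cases h.matched hv hu with
  | idle hA ha hb hp' hs he => exact ⟨ha, hb, hp', Or.inl ⟨hA, he⟩⟩
  | update hA hg ha hb hp hs he => contradiction
  | matchFirst hA hg hf' =>
    exact (hf' (askFirst_eq_none_of_askSecond hv hu hf)).elim
  | matchSecond hA hg hf' hsv hc ha hb hp' hs he =>
    refine ⟨ha, hb, hp'.trans hp.symm, Or.inr ⟨hA, ?_⟩⟩
    rw [he, decide_eq_true_eq]
    exact ⟨hp, hpp, hpu⟩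
  | resetMatch hA hg hf' hc => simp [hf, hs] at hc

/-- `u` is first, `v` is second, and both have completed their rematch. -/
structure Locked (G : SimpleGraph V) (m : V → Option V) (C : MMConfig V) (u v : V) : Prop where
  notA_first : ¬ guardUpdateA G m C u
  notA_second : ¬ guardUpdateA G m C v
  p_first : C.p u = askFirst m C u
  pp_first : ppEq C u
  p_second : C.p v = askSecond m C v
  pp_second : ppEq C v
  s_first : C.s u = true

theorem Locked.step (hL : Locked G m C u v) (h : LocalStep G m C C' A) (hu : m u = some v)
    (hv : m v = some u) : Locked G m C' u v ∧ (v ∈ A ∨ C.e v = true → C'.e v = true) ∧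
      (C.e v = true → u ∈ A ∨ C.e u = true → C'.e u = true) := by
  obtain ⟨ha, hb, hp, hc⟩ := h.first_hold hu hv hL.notA_first hL.p_first hL.pp_first
  obtain ⟨ha', hb', hp', hc'⟩ :=
    h.second_hold hu hv hL.notA_second hL.p_second hL.pp_second hL.s_first hL.p_first
  refine ⟨⟨h.not_guardUpdateA hu hv (Or.inr hL.notA_first),
    h.not_guardUpdateA hv hu (Or.inr hL.notA_second), ?_,
    h.ppEq_next (by simp [hu]) hL.notA_first hL.pp_first hp, ?_,
    h.ppEq_next (by simp [hv]) hL.notA_second hL.pp_second hp', ?_⟩, ?_, ?_⟩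
  · rw [hp, hL.p_first, askFirst_congr hu ha hb ha' hb']
  · rw [hp', hL.p_second, askSecond_congr hv hu ha' hb' ha hb]
  · rcases hc with ⟨-, hs, -⟩ | ⟨-, hs, -⟩
    · rw [hs, hL.s_first]
    · rw [hs, decide_eq_true_eq]
      exact ⟨hL.p_first, hL.pp_first, Or.inl hL.p_second⟩
  · rcases hc' with ⟨h1, h2⟩ | ⟨h1, h2⟩
    · rw [h2]
      exact fun h => h.resolve_left h1
    · exact fun _ => h2
  · intro hev
    rcases hc with ⟨h1, -, h2⟩ | ⟨h1, -, h2⟩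
    · rw [h2]
      exact fun h => h.resolve_left h1
    · rw [h2, decide_eq_true_eq]
      exact fun _ => ⟨hL.p_first, hL.pp_first, hL.s_first, hL.p_second, hev⟩

/-- `u` sets or keeps its end flag as long as its partner `v` does not move. -/
def Ended (G : SimpleGraph V) (m : V → Option V) (C : MMConfig V) (u v : V) : Prop :=
  ¬ guardUpdateA G m C u ∧ ppEq C u ∧
  ((C.p u = askFirst m C u ∧ C.s u = true ∧ C.p v = askSecond m C v ∧ C.e v = true) ∨
    (C.p u = askSecond m C u ∧ C.s v = true ∧ C.p v = askFirst m C v))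

theorem Ended.step (hE : Ended G m C u v) (h : LocalStep G m C C' A) (hu : m u = some v)
    (hv : m v = some u) (hvA : v ∉ A) :
    Ended G m C' u v ∧ (u ∈ A ∨ C.e u = true → C'.e u = true) := by
  obtain ⟨hA, hpp, hE⟩ := hE
  cases h.matched hv hu with
  | idle hvA ha' hb' hp' hs' he' =>
    rcases hE with ⟨h1, h2, h3, h4⟩ | ⟨h1, h2, h3⟩
    · obtain ⟨ha, hb, hp, hc⟩ := h.first_hold hu hv hA h1 hpp
      refine ⟨⟨h.not_guardUpdateA hu hv (Or.inr hA), h.ppEq_next (by simp [hu]) hA hpp hp,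
        Or.inl ⟨?_, ?_, ?_, ?_⟩⟩, ?_⟩
      · rw [hp, h1, askFirst_congr hu ha hb ha' hb']
      · rcases hc with ⟨-, hs, -⟩ | ⟨-, hs, -⟩
        · rw [hs, h2]
        · rw [hs, decide_eq_true_eq]
          exact ⟨h1, hpp, Or.inl h3⟩
      · rw [hp', h3, askSecond_congr hv hu ha' hb' ha hb]
      · rw [he', h4]
      · rcases hc with ⟨h5, -, h6⟩ | ⟨h5, -, h6⟩
        · rw [h6]
          exact fun h => h.resolve_left h5
        · rw [h6, decide_eq_true_eq]
          exact fun _ => ⟨h1, hpp, h2, h3, h4⟩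
    · obtain ⟨ha, hb, hp, hc⟩ := h.second_hold hv hu hA h1 hpp h2 h3
      refine ⟨⟨h.not_guardUpdateA hu hv (Or.inr hA), h.ppEq_next (by simp [hu]) hA hpp hp,
        Or.inr ⟨?_, ?_, ?_⟩⟩, ?_⟩
      · rw [hp, h1, askSecond_congr hu hv ha hb ha' hb']
      · rw [hs', h2]
      · rw [hp', h3, askFirst_congr hv ha' hb' ha hb]
      · rcases hc with ⟨h5, h6⟩ | ⟨h5, h6⟩
        · rw [h6]
          exact fun h => h.resolve_left h5
        · exact fun _ => h6
  | _ => contradiction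

/-- The end flag of `u` is set as soon as `u` moves, and then for ever. -/
def PermEnded (G : SimpleGraph V) (m : V → Option V) (C : MMConfig V) (u v : V) : Prop :=
  (Locked G m C u v ∧ C.e v = true) ∨ Locked G m C v u

theorem PermEnded.step (hE : PermEnded G m C u v) (h : LocalStep G m C C' A) (hu : m u = some v)
    (hv : m v = some u) :
    PermEnded G m C' u v ∧ (u ∈ A ∨ C.e u = true → C'.e u = true) := by
  rcases hE with ⟨hL, he⟩ | hL
  · obtain ⟨h1, h2, h3⟩ := hL.step h hu hv
    exact ⟨Or.inl ⟨h1, h2 (Or.inr he)⟩, h3 he⟩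
  · obtain ⟨h1, h2, -⟩ := hL.step h hv hu
    exact ⟨Or.inr h1, h2⟩

theorem Ended.permEnded (hE : Ended G m C u v) (hv : Good G m C v) : PermEnded G m C u v := by
  obtain ⟨hA, hpp, ⟨h1, h2, h3, h4⟩ | ⟨h1, h2, h3⟩⟩ := hE
  · exact Or.inl ⟨⟨hA, hv.1, h1, hpp, h3, hv.2 (Or.inr h4), h2⟩, h4⟩
  · exact Or.inr ⟨hv.1, hA, h3, hv.2 (Or.inl h2), h1, hpp, h2⟩

theorem LocalStep.ended (h : LocalStep G m C C' A) (hu : m u = some v) (hv : m v = some u)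
    (he0 : C.e u = false) (he1 : C'.e u = true) : Ended G m C u v := by
  cases h.matched hu hv with
  | idle hA ha hb hp hs he => simp_all
  | update hA hg ha hb hp hs he => simp_all
  | matchFirst hA hg hf hc ha hb hp hs he =>
    rw [he, decide_eq_true_eq] at he1
    obtain ⟨h1, h2, h3, h4, h5⟩ := he1
    exact ⟨fun h => hg (Or.inl h), h2, Or.inl ⟨h1, h3, h4, h5⟩⟩
  | matchSecond hA hg hf hsv hc ha hb hp hs he =>
    rw [he, decide_eq_true_eq] at he1
    obtain ⟨h1, h2, h3⟩ := he1
    exact ⟨fun h => hg (Or.inl h), h2, Or.inr ⟨h1, hsv, h3⟩⟩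
  | resetMatch hA hg hf hc ha hb hp hs he => simp_all

/-- Potential of the matched edge `u, v`. -/
noncomputable def pairPot (m : V → Option V) (C : MMConfig V) (u v : V) : ℕ :=
  if askFirst m C u ≠ none then
    if askFirst m C v ≠ none then
      bothPot (decide (C.p u = askFirst m C u)) (C.s u) (C.e u) (decide (C.p u = none))
        (decide (C.p v = askFirst m C v)) (C.s v) (C.e v) (decide (C.p v = none))
    else
      normalPot (decide (C.p u = askFirst m C u)) (C.s u) (C.e u)
        (decide (C.p v = askSecond m C v)) (decide (C.p v = none)) (C.s v) (C.e v)
  else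
    if askFirst m C v ≠ none then
      normalPot (decide (C.p v = askFirst m C v)) (C.s v) (C.e v)
        (decide (C.p u = askSecond m C u)) (decide (C.p u = none)) (C.s u) (C.e u)
    else
      restPot (decide (C.p u = none ∧ C.s u = false ∧ C.e u = false))
        (decide (C.p v = none ∧ C.s v = false ∧ C.e v = false))

theorem pairPot_le (C : MMConfig V) (u v : V) : pairPot m C u v ≤ 12 := by
  unfold pairPot
  split_ifs
  · exact bothPot_le ..
  · exact normalPot_le ..
  · exact normalPot_le ..
  · unfold restPot
    have h1 := Bool.toNat_le (decide (C.p u = none ∧ C.s u = false ∧ C.e u = false))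
    have h2 := Bool.toNat_le (decide (C.p v = none ∧ C.s v = false ∧ C.e v = false))
    omega

theorem LocalStep.idle (h : LocalStep G m C C' A) (hA : u ∉ A) : C'.a u = C.a u ∧
    C'.b u = C.b u ∧ C'.p u = C.p u ∧ C'.s u = C.s u ∧ C'.e u = C.e u := by
  rcases h u with ⟨hA', -⟩ | ⟨-, hl⟩
  · contradiction
  · simp only [MMConfig.loc, MMLocal.mk.injEq] at hl
    tauto

theorem LocalStep.asks_eq (h : LocalStep G m C C' A) (hu : m u = some v) (hv : m v = some u)
    (hU : ¬ (u ∈ A ∧ guardUpdate G m C u)) : C'.a u = C.a u ∧ C'.b u = C.b u := by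
  cases h.matched hu hv with
  | update hA hg => exact (hU ⟨hA, hg⟩).elim
  | _ => exact ⟨by assumption, by assumption⟩

theorem LocalStep.firstMove (h : LocalStep G m C C' A) (hu : m u = some v) (hv : m v = some u)
    (hA : u ∈ A) (hU : ¬ (u ∈ A ∧ guardUpdate G m C u)) (hG : Good G m C u)
    (hf : askFirst m C u ≠ none) {B D : Bool}
    (hB : B = decide (C.p v = askSecond m C v ∨ C.p v = none))
    (hD : D = decide (C.p v = askSecond m C v ∧ C.e v = true)) :
    FirstMove (decide (C.p u = askFirst m C u)) (C.s u) (C.e u) B D (decide (ppEq C u))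
      (decide (C'.p u = askFirst m C u)) (C'.s u) (C'.e u) ∧ decide (C'.p u = none) = false := by
  have hS : (decide (C.p u = askFirst m C u) && decide (ppEq C u) && B) =
      decide (mfS m C u v) := by
    rw [hB, Bool.eq_iff_iff, decide_eq_true_eq (p := mfS m C u v)]
    simp [mfS, and_assoc]
  have hE : (decide (C.p u = askFirst m C u) && decide (ppEq C u) && C.s u && D) =
      decide (mfE m C u v) := by
    rw [hD, Bool.eq_iff_iff, decide_eq_true_eq (p := mfE m C u v)]
    simp [mfE, and_assoc]
  cases h.matched hu hv with
  | idle hA' => contradiction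
  | update hA hg => exact (hU ⟨hA, hg⟩).elim
  | matchFirst hA hg hf hc ha hb hp hs he =>
    refine ⟨⟨fun ht => ?_, ?_, by simp [hp], by rw [hS, hs], by rw [hE, he]⟩, by simp [hp, hf]⟩
    · rw [decide_eq_true_eq]
      exact hG.2 (by simpa using ht)
    · rw [hS, hE]
      simpa using hc
  | matchSecond hA hg hf' => exact (hf' (askSecond_eq_none_of_askFirst hu hv hf)).elim
  | resetMatch hA hg hf' => contradiction

theorem LocalStep.secondMove (h : LocalStep G m C C' A) (hu : m u = some v) (hv : m v = some u)
    (hA : v ∈ A) (hU : ¬ (v ∈ A ∧ guardUpdate G m C v)) (hG : Good G m C v)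
    (hfu : askFirst m C u ≠ none) (hf : askFirst m C v = none) :
    SecondMove (decide (C.p v = askSecond m C v)) (decide (C.p v = none)) (C.s v) (C.e v)
      (decide (C.p u = askFirst m C u)) (C.s u) (decide (ppEq C v))
      (decide (C'.p v = askSecond m C v)) (decide (C'.p v = none)) (C'.s v) (C'.e v) := by
  have hn := askSecond_ne_none hu hv hG.1 hfu hf
  have hE : (decide (C.p v = askSecond m C v) && decide (ppEq C v) &&
      decide (C.p u = askFirst m C u)) = decide (msE m C v u) := by
    rw [Bool.eq_iff_iff, decide_eq_true_eq (p := msE m C v u)]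
    simp [msE, and_assoc]
  refine ⟨fun ht => ?_, ?_, ?_⟩
  · rw [decide_eq_true_eq]
    exact hG.2 (by simpa using ht)
  · by_contra hne
    simp only [Bool.not_eq_false, Bool.and_eq_true, decide_eq_true_eq] at hne
    exact hn (hne.1 ▸ hne.2)
  · rw [hE]
    cases h.matched hv hu with
    | idle hA' => contradiction
    | update hA hg => exact (hU ⟨hA, hg⟩).elim
    | matchFirst hA hg hf' => contradiction
    | matchSecond hA hg hf' hsv hc ha hb hp hs he =>
      refine Or.inl ⟨hsv, by simpa using hc, by simp [hp], by simp [hp, hn], hs, he⟩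
    | resetMatch hA hg hf' hc ha hb hp hs he =>
      simp only [hn, false_and, ne_eq, not_false_eq_true, true_and, false_or] at hc
      refine Or.inr ⟨hc.2, by simp [hc.1], by simp [hp, hn.symm], by simp [hp], hs, he⟩

theorem LocalStep.normalPot_lt (h : LocalStep G m C C' A) (hu : m u = some v) (hv : m v = some u)
    (hUu : ¬ (u ∈ A ∧ guardUpdate G m C u)) (hUv : ¬ (v ∈ A ∧ guardUpdate G m C v))
    (hGu : u ∈ A → Good G m C u) (hGv : v ∈ A → Good G m C v)
    (hfu : askFirst m C u ≠ none) (hfv : askFirst m C v = none) (hA : u ∈ A ∨ v ∈ A) :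
    normalPot (decide (C.p u = askFirst m C u)) (C.s u) (C.e u)
        (decide (C.p v = askSecond m C v)) (decide (C.p v = none)) (C.s v) (C.e v) <
      normalPot (decide (C'.p u = askFirst m C u)) (C'.s u) (C'.e u)
        (decide (C'.p v = askSecond m C v)) (decide (C'.p v = none)) (C'.s v) (C'.e v) := by
  have hF := fun hA => (h.firstMove hu hv hA hUu (hGu hA) hfu
    (B := decide (C.p v = askSecond m C v) || decide (C.p v = none))
    (D := decide (C.p v = askSecond m C v) && C.e v) (by simp) (by simp)).1
  have hS := fun hA => h.secondMove hu hv hA hUv (hGv hA) hfu hfv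
  refine _root_.normalPot_lt ?_ ?_ (hA.imp hF hS)
  · by_cases huA : u ∈ A
    · exact Or.inr (hF huA)
    · obtain ⟨-, -, h1, h2, h3⟩ := h.idle huA
      exact Or.inl ⟨by rw [h1], h2, h3⟩
  · by_cases hvA : v ∈ A
    · exact Or.inr (hS hvA)
    · obtain ⟨-, -, h1, h2, h3⟩ := h.idle hvA
      exact Or.inl ⟨by rw [h1], by rw [h1], h2, h3⟩

theorem LocalStep.bothPot_lt (h : LocalStep G m C C' A) (hu : m u = some v) (hv : m v = some u)
    (hUu : ¬ (u ∈ A ∧ guardUpdate G m C u)) (hUv : ¬ (v ∈ A ∧ guardUpdate G m C v))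
    (hGu : u ∈ A → Good G m C u) (hGv : v ∈ A → Good G m C v)
    (hfu : askFirst m C u ≠ none) (hfv : askFirst m C v ≠ none) (hA : u ∈ A ∨ v ∈ A) :
    bothPot (decide (C.p u = askFirst m C u)) (C.s u) (C.e u) (decide (C.p u = none))
        (decide (C.p v = askFirst m C v)) (C.s v) (C.e v) (decide (C.p v = none)) <
      bothPot (decide (C'.p u = askFirst m C u)) (C'.s u) (C'.e u) (decide (C'.p u = none))
        (decide (C'.p v = askFirst m C v)) (C'.s v) (C'.e v) (decide (C'.p v = none)) := by
  have hsu := askSecond_eq_none_of_askFirst hu hv hfu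
  have hsv := askSecond_eq_none_of_askFirst hv hu hfv
  have hFu := fun hA => h.firstMove hu hv hA hUu (hGu hA) hfu
    (B := decide (C.p v = none)) (D := decide (C.p v = none) && C.e v) (by simp [hsv])
    (by simp [hsv])
  have hFv := fun hA => h.firstMove hv hu hA hUv (hGv hA) hfv
    (B := decide (C.p u = none)) (D := decide (C.p u = none) && C.e u) (by simp [hsu])
    (by simp [hsu])
  refine _root_.bothPot_lt ?_ ?_ ?_ ?_ (hA.imp hFu hFv)
  · by_contra hne
    simp only [Bool.not_eq_false, Bool.and_eq_true, decide_eq_true_eq] at hne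
    exact hfu (hne.1 ▸ hne.2)
  · by_contra hne
    simp only [Bool.not_eq_false, Bool.and_eq_true, decide_eq_true_eq] at hne
    exact hfv (hne.1 ▸ hne.2)
  · by_cases huA : u ∈ A
    · exact Or.inr (hFu huA)
    · obtain ⟨-, -, h1, h2, h3⟩ := h.idle huA
      exact Or.inl ⟨by rw [h1], h2, h3, by rw [h1]⟩
  · by_cases hvA : v ∈ A
    · exact Or.inr (hFv hvA)
    · obtain ⟨-, -, h1, h2, h3⟩ := h.idle hvA
      exact Or.inl ⟨by rw [h1], h2, h3, by rw [h1]⟩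

theorem LocalStep.rest_reset (h : LocalStep G m C C' A) (hu : m u = some v) (hv : m v = some u)
    (hA : u ∈ A) (hU : ¬ (u ∈ A ∧ guardUpdate G m C u))
    (hfu : askFirst m C u = none) (hfv : askFirst m C v = none) :
    ¬ (C.p u = none ∧ C.s u = false ∧ C.e u = false) ∧
      (C'.p u = none ∧ C'.s u = false ∧ C'.e u = false) := by
  have hs : askSecond m C u = none := by rw [askSecond_eq hu, if_neg (not_not.2 hfv)]
  cases h.matched hu hv with
  | idle hA' => contradiction
  | update hA hg => exact (hU ⟨hA, hg⟩).elim
  | matchFirst hA hg hf => contradiction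
  | matchSecond hA hg hf => contradiction
  | resetMatch hA hg hf hc ha hb hp hs' he =>
    exact ⟨by simpa [hs] using hc, hp, hs', he⟩

theorem restPot_lt {P P' Q Q' : Prop} [Decidable P] [Decidable P'] [Decidable Q] [Decidable Q']
    (h1 : P → P') (h2 : Q → Q')
    (h : ¬ P ∧ P' ∨ ¬ Q ∧ Q') :
    restPot (decide P) (decide Q) < restPot (decide P') (decide Q') := by
  by_cases hP : P <;> by_cases hQ : Q <;> by_cases hP' : P' <;> by_cases hQ' : Q' <;>
    simp_all [restPot]

theorem LocalStep.restPot_lt (h : LocalStep G m C C' A) (hu : m u = some v) (hv : m v = some u)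
    (hUu : ¬ (u ∈ A ∧ guardUpdate G m C u)) (hUv : ¬ (v ∈ A ∧ guardUpdate G m C v))
    (hfu : askFirst m C u = none) (hfv : askFirst m C v = none) (hA : u ∈ A ∨ v ∈ A) :
    restPot (decide (C.p u = none ∧ C.s u = false ∧ C.e u = false))
        (decide (C.p v = none ∧ C.s v = false ∧ C.e v = false)) <
      restPot (decide (C'.p u = none ∧ C'.s u = false ∧ C'.e u = false))
        (decide (C'.p v = none ∧ C'.s v = false ∧ C'.e v = false)) := by
  have hRu := fun hA => h.rest_reset hu hv hA hUu hfu hfv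
  have hRv := fun hA => h.rest_reset hv hu hA hUv hfv hfu
  refine _root_.restPot_lt ?_ ?_ (hA.imp hRu hRv)
  · intro h0
    by_cases huA : u ∈ A
    · exact (hRu huA).2
    · obtain ⟨-, -, h1, h2, h3⟩ := h.idle huA
      rwa [h1, h2, h3]
  · intro h0
    by_cases hvA : v ∈ A
    · exact (hRv hvA).2
    · obtain ⟨-, -, h1, h2, h3⟩ := h.idle hvA
      rwa [h1, h2, h3]

/-- As long as neither endpoint updates, each move on a matched edge increases its potential. -/
theorem LocalStep.pairPot_lt (h : LocalStep G m C C' A) (hu : m u = some v) (hv : m v = some u)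
    (hUu : ¬ (u ∈ A ∧ guardUpdate G m C u)) (hUv : ¬ (v ∈ A ∧ guardUpdate G m C v))
    (hGu : u ∈ A → Good G m C u) (hGv : v ∈ A → Good G m C v) (hA : u ∈ A ∨ v ∈ A) :
    pairPot m C u v < pairPot m C' u v := by
  obtain ⟨ha, hb⟩ := h.asks_eq hu hv hUu
  obtain ⟨ha', hb'⟩ := h.asks_eq hv hu hUv
  unfold pairPot
  rw [askFirst_congr hu ha hb ha' hb', askFirst_congr hv ha' hb' ha hb,
    askSecond_congr hu hv ha hb ha' hb', askSecond_congr hv hu ha' hb' ha hb]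
  split_ifs with hfu hfv hfv
  · exact h.bothPot_lt hu hv hUu hUv hGu hGv hfu hfv hA
  · exact h.normalPot_lt hu hv hUu hUv hGu hGv hfu (not_not.1 hfv) hA
  · exact h.normalPot_lt hv hu hUv hUu hGv hGu hfv (not_not.1 hfu) hA.symm
  · exact h.restPot_lt hu hv hUu hUv (not_not.1 hfu) (not_not.1 hfv) hA

theorem LocalStep.pairPot_eq (h : LocalStep G m C C' A) (hu : m u = some v) (hv : m v = some u)
    (hAu : u ∉ A) (hAv : v ∉ A) : pairPot m C' u v = pairPot m C u v := by
  obtain ⟨ha, hb, hp, hs, he⟩ := h.idle hAu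
  obtain ⟨ha', hb', hp', hs', he'⟩ := h.idle hAv
  unfold pairPot
  rw [askFirst_congr hu ha hb ha' hb', askFirst_congr hv ha' hb' ha hb,
    askSecond_congr hu hv ha hb ha' hb', askSecond_congr hv hu ha' hb' ha hb,
    hp, hs, he, hp', hs', he']

end Steps

theorem exists_rise {f : ℕ → Bool} {a b : ℕ} (hab : a ≤ b) (ha : f a = false) (hb : f b = true) :
    ∃ t, a ≤ t ∧ t < b ∧ f t = false ∧ f (t + 1) = true := by
  induction b, hab using Nat.le_induction with
  | base => simp [ha] at hb
  | succ b hab ih =>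
    cases hfb : f b with
    | false => exact ⟨b, hab, Nat.lt_succ_self b, hfb, hb⟩
    | true =>
      obtain ⟨t, h1, h2, h3⟩ := ih hfb
      exact ⟨t, h1, h2.trans (Nat.lt_succ_self b), h3⟩

theorem sum_cnt_fiber_le {ι : Type*} [Fintype ι] (S : ℕ → Prop) (f : ℕ → Option ι) (N : ℕ) :
    ∑ x, cnt (fun t => S t ∧ f t = some x) N ≤ cnt S N := by
  induction N with
  | zero => simp [cnt_zero]
  | succ N ih =>
    simp only [cnt_succ, Finset.sum_add_distrib]
    refine Nat.add_le_add ih ?_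
    by_cases hS : S N
    · cases hf : f N with
      | none => simp
      | some y => simp [hS]
    · simp [hS]

section Executions

variable {V : Type*} [Fintype V] [LinearOrder V] {G : SimpleGraph V} {m : V → Option V}
  {C C' : MMConfig V} {A : Set V} {u v x w : V}

theorem LocalStep.p_eq_of_e (h : LocalStep G m C C' A) (hu : m u = some v) (hv : m v = some u)
    (he : C'.e u = true) : C'.p u = C.p u := by
  by_cases hA : u ∈ A
  · exact (h.mutual_of_true hu hv hA (Or.inr he)).1
  · exact (h.idle hA).2.2.1

theorem LocalStep.single_e_keep (h : LocalStep G m C C' A) (hx : m x = none) (hadj : G.Adj x w)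
    (hw : m w ≠ none) (hp : C.p w = some x) (hpx : C.p x = some w) (hew : C.e w = true)
    (hex : C.e x = true) : C'.e x = true := by
  cases h.single hx with
  | idle hA hp' he => rw [he, hex]
  | resetEnd hA hp0 he0 hp' he => simp [hpx] at hp0
  | updateP hA hg hp' he =>
    simp only [guardUpdateP, hpx] at hg
    simp_all
  | updateEnd hA w' hw' hadj hm hpw hne hp' he =>
    obtain rfl : w = w' := by simpa [hpx] using hw'
    rw [he, hew]

theorem LocalStep.candSet_eq (h : LocalStep G m C C' A)
    (he : ∀ x, m x = none → C'.e x = C.e x) (v : V) : candSet G m C' v = candSet G m C v := by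
  ext x
  simp only [candSet, Set.mem_ofPred_eq]
  refine and_congr_right fun _ => and_congr_right fun hx => ?_
  have hex := he x hx
  cases h.single hx with
  | idle hA hp' he => rw [hex, hp']
  | resetEnd hA hp0 he0 hp' he => rw [hex, hp']
  | updateP hA hg hp' he =>
    have : C.e x = false := hex.symm.trans he
    simp [he, this]
  | updateEnd hA w' hw' hadj hm hpw hne hp' he => rw [hex, hp']

namespace MMExecution

variable (E : MMExecution G m)

/-- The end flag of `u` is raised at step `i`. -/
def EndRise (u : V) (i : ℕ) : Prop := (E.cfg i).e u = false ∧ (E.cfg (i + 1)).e u = true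

/-- The end flag of `u` changes at step `i`. -/
def EndChange (u : V) (i : ℕ) : Prop := (E.cfg (i + 1)).e u ≠ (E.cfg i).e u

/-- `u` executes `Update` at step `i`. -/
def Updates (u : V) (i : ℕ) : Prop := u ∈ E.act i ∧ guardUpdate G m (E.cfg i) u

/-- `x` executes `UpdateP` at step `i`. -/
def UpdatesP (x : V) (i : ℕ) : Prop := x ∈ E.act i ∧ guardUpdateP G m (E.cfg i) x ∧
  (E.cfg (i + 1)).p x = lowestSet {w | G.Adj x w ∧ (E.cfg i).p w = some x}

theorem good_of_moved (hu : m u = some v) (hv : m v = some u) {i k : ℕ} (hk : k < i)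
    (hact : u ∈ E.act k) : Good G m (E.cfg i) u := by
  induction i, Nat.succ_le_of_lt hk using Nat.le_induction with
  | base => exact (E.localStep k).good hu hv (Or.inl hact)
  | succ i hi ih => exact (E.localStep i).good hu hv (Or.inr (ih hi))

theorem cnt_endRise_matched (hu : m u = some v) (hv : m v = some u) (N : ℕ) :
    cnt (E.EndRise u) N ≤ 2 := by
  have h1 := cnt_le_one (P := fun i => E.EndRise u i ∧ ∃ k < i, v ∈ E.act k) (by
    rintro i j hij ⟨hi, k, hk, hvk⟩ ⟨hj, -⟩
    have hP := ((E.localStep i).ended hu hv hi.1 hi.2).permEnded (E.good_of_moved hv hu hk hvk)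
    have key : ∀ t, i + 1 ≤ t → PermEnded G m (E.cfg t) u v ∧ (E.cfg t).e u = true := by
      intro t ht
      induction t, ht using Nat.le_induction with
      | base => exact ⟨(hP.step (E.localStep i) hu hv).1, hi.2⟩
      | succ t ht ih =>
        obtain ⟨h3, h4⟩ := ih.1.step (E.localStep t) hu hv
        exact ⟨h3, h4 (Or.inr ih.2)⟩
    have := key j hij
    simp [hj.1] at this) N
  have h2 := cnt_le_one (P := fun i => E.EndRise u i ∧ ∀ k < i, v ∉ E.act k) (by
    rintro i j hij ⟨hi, -⟩ ⟨hj, hv'⟩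
    have hP := (E.localStep i).ended hu hv hi.1 hi.2
    have key : ∀ t, i + 1 ≤ t → t ≤ j →
        Ended G m (E.cfg t) u v ∧ (E.cfg t).e u = true := by
      intro t ht
      induction t, ht using Nat.le_induction with
      | base => exact fun _ => ⟨(hP.step (E.localStep i) hu hv (hv' i hij)).1, hi.2⟩
      | succ t ht ih =>
        intro htj
        obtain ⟨h1, h2⟩ := ih (by omega)
        obtain ⟨h3, h4⟩ := h1.step (E.localStep t) hu hv (hv' t (by omega))
        exact ⟨h3, h4 (Or.inr h2)⟩
    have := key j hij le_rfl
    simp [hj.1] at this) N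
  have h3 := cnt_or (P := E.EndRise u) (Q := fun i => E.EndRise u i ∧ ∃ k < i, v ∈ E.act k)
    (R := fun i => E.EndRise u i ∧ ∀ k < i, v ∉ E.act k) (fun i hi => by
      by_cases h : ∃ k < i, v ∈ E.act k
      · exact Or.inl ⟨hi, h⟩
      · exact Or.inr ⟨hi, by simpa using h⟩) N
  omega

theorem EndRise.single {E : MMExecution G m} {i : ℕ} (h : E.EndRise x i) (hx : m x = none) :
    ∃ w, (E.cfg i).p x = some w ∧ G.Adj x w ∧ m w ≠ none ∧ (E.cfg i).p w = some x ∧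
      (E.cfg i).e w = true := by
  obtain ⟨h0, h1⟩ := h
  cases (E.localStep i).single hx with
  | idle hA hp he => simp [he, h0] at h1
  | resetEnd hA hp0 he0 hp he => simp [he] at h1
  | updateP hA hg hp he => simp [he] at h1
  | updateEnd hA w hw hadj hm hpw hne hp he => exact ⟨w, hw, hadj, hm, hpw, he ▸ h1⟩

theorem cnt_endRise_via (hM : MaxMatchingOn G m) (hx : m x = none) (w : V) (N : ℕ) :
    cnt (fun i => E.EndRise x i ∧ (E.cfg i).p x = some w) N ≤ 3 := by
  cases hw : m w with
  | none =>
    refine (cnt_le_one ?_ N).trans (by norm_num)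
    rintro i - - ⟨hi, hp⟩ -
    obtain ⟨w', hw', -, hm, -⟩ := hi.single hx
    obtain rfl : w = w' := by simpa [hp] using hw'
    exact hm hw
  | some v =>
    have hv := hM.symm _ _ hw
    have hwn : m w ≠ none := by simp [hw]
    refine (cnt_le_of_between (Q := E.EndRise w) ?_ N).trans
      (Nat.succ_le_succ (E.cnt_endRise_matched hw hv N))
    rintro i j hij ⟨hi, hp⟩ ⟨hj, hpj⟩ -
    obtain ⟨w', hw', hadj, hm, hpw, hew⟩ := hi.single hx
    obtain rfl : w = w' := by simpa [hp] using hw'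
    obtain ⟨w', hw', -, -, hpwj, hewj⟩ := hj.single hx
    obtain rfl : w = w' := by simpa [hpj] using hw'
    by_contra hno
    push Not at hno
    have he : ∀ t, i ≤ t → t ≤ j → (E.cfg t).e w = true := by
      intro t h1 h2
      by_contra hne
      obtain ⟨s, hs1, hs2, hs⟩ := exists_rise (f := fun t => (E.cfg t).e w) h2
        (by simpa using hne) hewj
      exact hno s (h1.trans hs1) hs2 hs
    have key : ∀ t, i + 1 ≤ t → t ≤ j → (E.cfg t).p w = some x ∧ (E.cfg t).p x = some w ∧
        (E.cfg t).e x = true := by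
      intro t ht
      induction t, ht using Nat.le_induction with
      | base =>
        intro htj
        exact ⟨by rw [(E.localStep i).p_eq_of_e hw hv (he _ (by omega) htj), hpw],
          (E.localStep i).pointer_eq hx hadj hwn hpw hp, hi.2⟩
      | succ t ht ih =>
        intro htj
        obtain ⟨h1, h2, h3⟩ := ih (by omega)
        exact ⟨by rw [(E.localStep t).p_eq_of_e hw hv (he _ (by omega) htj), h1],
          (E.localStep t).pointer_eq hx hadj hwn h1 h2,
          (E.localStep t).single_e_keep hx hadj hwn h1 h2 (he t (by omega) (by omega)) h3⟩
    have := (key j hij le_rfl).2.2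
    simp [hj.1] at this

theorem cnt_endChange (hM : MaxMatchingOn G m) (hx : m x = none) (N : ℕ) :
    cnt (E.EndChange x) N ≤ 6 * Fintype.card V + 1 := by
  have h1 : cnt (E.EndRise x) N ≤ 3 * Fintype.card V := by
    refine (cnt_exists (Q := fun w i => E.EndRise x i ∧ (E.cfg i).p x = some w)
      (fun i hi => ?_) N).trans ?_
    · obtain ⟨w, hw, -⟩ := hi.single hx
      exact ⟨w, hi, hw⟩
    · refine (Finset.sum_le_sum fun w _ => E.cnt_endRise_via hM hx w N).trans ?_
      simp [mul_comm]
  have h2 : cnt (fun i => (E.cfg i).e x = true ∧ (E.cfg (i + 1)).e x = false) N ≤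
      cnt (E.EndRise x) N + 1 := by
    refine cnt_le_of_between ?_ N
    rintro i j hij ⟨-, hi⟩ ⟨hj, -⟩ -
    obtain ⟨s, hs1, hs2, hs⟩ := exists_rise (f := fun t => (E.cfg t).e x) hij hi hj
    exact ⟨s, by omega, hs2, hs⟩
  have h3 := cnt_or (P := E.EndChange x) (Q := E.EndRise x)
    (R := fun i => (E.cfg i).e x = true ∧ (E.cfg (i + 1)).e x = false) (fun i hi => by
      unfold EndChange at hi
      unfold EndRise
      cases h : (E.cfg i).e x <;> cases h' : (E.cfg (i + 1)).e x <;> simp_all) N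
  omega

theorem cnt_updates (hM : MaxMatchingOn G m) (hv : m v = some u) (N : ℕ) :
    cnt (E.Updates v) N ≤ Fintype.card V * (6 * Fintype.card V + 1) + 1 := by
  have hu := hM.symm _ _ hv
  refine (cnt_le_of_between (Q := fun t => ∃ x, m x = none ∧ E.EndChange x t) ?_ N).trans
    (Nat.succ_le_succ ?_)
  · intro i j hij hi hj hno
    by_contra hQ
    push Not at hQ
    have hcand : ∀ t, i ≤ t → t ≤ j → candSet G m (E.cfg t) v = candSet G m (E.cfg i) v := by
      intro t ht
      induction t, ht using Nat.le_induction with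
      | base => exact fun _ => rfl
      | succ t ht ih =>
        intro htj
        rw [← ih (by omega)]
        exact (E.localStep t).candSet_eq
          (fun x hx => not_not.1 (hQ t ht (by omega) x hx)) v
    have hab : ∀ t, i + 1 ≤ t → t ≤ j →
        ((E.cfg t).a v, (E.cfg t).b v) = bestRematch G m (E.cfg i) v := by
      intro t ht
      induction t, ht using Nat.le_induction with
      | base =>
        intro _
        cases (E.localStep i).matched hv hu with
        | update hA hg ha hb => rw [ha, hb]
        | idle hA => exact (hA hi.1).elim
        | _ => exact absurd hi.2 (by assumption)
      | succ t ht ih =>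
        intro htj
        obtain ⟨ha, hb⟩ := (E.localStep t).asks_eq hv hu (hno t (by omega) (by omega))
        rw [ha, hb]
        exact ih (by omega)
    rcases hj.2 with h | ⟨h, -⟩
    · exact (E.good_of_moved hv hu hij hi.1).1 h
    · refine h ((hab j hij le_rfl).trans ?_)
      simp only [bestRematch, hcand j hij.le le_rfl]
  · refine (cnt_exists (Q := fun x t => m x = none ∧ E.EndChange x t) (fun t h => h) N).trans ?_
    refine (Finset.sum_le_card_nsmul _ _ (6 * Fintype.card V + 1) fun x _ => ?_).trans (by simp)
    by_cases hx : m x = none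
    · exact (cnt_le_cnt (fun t h => h.2) N).trans (E.cnt_endChange hM hx N)
    · refine (cnt_le_one ?_ N).trans (by omega)
      exact fun _ _ _ h => (hx h.1).elim

theorem cnt_moves_matched (hM : MaxMatchingOn G m) (hu : m u = some v) (N : ℕ) :
    cnt (fun i => u ∈ E.act i) N ≤ 246 * Fintype.card V ^ 2 := by
  have hv := hM.symm _ _ hu
  have hbad : ∀ {u v : V}, m u = some v → m v = some u →
      cnt (fun i => u ∈ E.act i ∧ ¬ Good G m (E.cfg i) u) N ≤ 1 := by
    intro u v hu hv
    refine cnt_le_one ?_ N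
    rintro i j hij ⟨hi, -⟩ ⟨-, hj⟩
    exact hj (E.good_of_moved hu hv hij hi)
  have h1 := cnt_or (P := fun i => (E.Updates u i ∨ E.Updates v i) ∨
      ((u ∈ E.act i ∧ ¬ Good G m (E.cfg i) u) ∨ (v ∈ E.act i ∧ ¬ Good G m (E.cfg i) v)))
    (fun i h => h) N
  have h2 := cnt_or (P := fun i => E.Updates u i ∨ E.Updates v i) (fun i h => h) N
  have h3 := cnt_or (P := fun i => (u ∈ E.act i ∧ ¬ Good G m (E.cfg i) u) ∨
    (v ∈ E.act i ∧ ¬ Good G m (E.cfg i) v)) (fun i h => h) N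
  have h4 := hbad hu hv
  have h5 := hbad hv hu
  have h6 := E.cnt_updates hM hu N
  have h7 := E.cnt_updates hM hv N
  have h8 := cnt_le_of_potential (P := fun i => u ∈ E.act i)
    (Q := fun i => (E.Updates u i ∨ E.Updates v i) ∨
      ((u ∈ E.act i ∧ ¬ Good G m (E.cfg i) u) ∨ (v ∈ E.act i ∧ ¬ Good G m (E.cfg i) v)))
    (f := fun i => pairPot m (E.cfg i) u v) (K := 12) (fun i => pairPot_le _ _ _) (by
      intro i hQ
      simp only [not_or, not_and, not_not] at hQ
      obtain ⟨⟨hUu, hUv⟩, hGu, hGv⟩ := hQ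
      by_cases hA : u ∈ E.act i ∨ v ∈ E.act i
      · have := (E.localStep i).pairPot_lt hu hv hUu hUv hGu hGv hA
        exact ⟨this.le, fun _ => this⟩
      · simp only [not_or] at hA
        exact ⟨((E.localStep i).pairPot_eq hu hv hA.1 hA.2).ge, fun h => (hA.1 h).elim⟩) N
  have hn : 1 ≤ Fintype.card V := Fintype.card_pos_iff.2 ⟨u⟩
  nlinarith

theorem cnt_updatesP (hM : MaxMatchingOn G m) (hx : m x = none) (N : ℕ) :
    cnt (E.UpdatesP x) N ≤ ∑ w, (cnt (fun t => (m w ≠ none ∧ w ∈ E.act t) ∧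
      (E.cfg t).p w = some x) N + cnt (fun t => (m w ≠ none ∧ w ∈ E.act t) ∧
      (E.cfg (t + 1)).p w = some x) N) + 1 := by
  refine (cnt_le_of_between (Q := fun t => ∃ w, (m w ≠ none ∧ w ∈ E.act t) ∧
    ((E.cfg t).p w = some x ∨ (E.cfg (t + 1)).p w = some x)) ?_ N).trans (Nat.succ_le_succ ?_)
  · intro i j hij hi hj hno
    have hp : ∀ t, i + 1 ≤ t → t ≤ j → (E.cfg t).p x = (E.cfg (i + 1)).p x := by
      intro t ht
      induction t, ht using Nat.le_induction with
      | base => exact fun _ => rfl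
      | succ t ht ih =>
        intro htj
        rw [← ih (by omega)]
        cases (E.localStep t).single hx with
        | updateP hA hg hp he => exact (hno t (by omega) (by omega) ⟨hA, hg, hp⟩).elim
        | _ => assumption
    have hmatched : ∀ w, G.Adj x w → m w ≠ none :=
      fun w hw => (hM.maximal x w hw).resolve_left (not_not.2 hx)
    by_contra hQ
    push Not at hQ
    have hstay : ∀ w, G.Adj x w → ∀ t, i ≤ t → t ≤ j →
        ((E.cfg t).p w = some x ↔ (E.cfg i).p w = some x) := by
      intro w hw t ht
      induction t, ht using Nat.le_induction with
      | base => exact fun _ => Iff.rfl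
      | succ t ht ih =>
        intro htj
        rw [← ih (by omega)]
        by_cases hA : w ∈ E.act t
        · have := hQ t ht (by omega) w ⟨hmatched w hw, hA⟩
          exact iff_of_false this.2 this.1
        · rw [((E.localStep t).idle hA).2.2.1]
    have hpj := (hp j hij le_rfl).trans hi.2.2
    cases hl : lowestSet {w | G.Adj x w ∧ (E.cfg i).p w = some x} with
    | none =>
      rw [hl] at hpj
      rcases hj.2.1 with ⟨-, w, hadj, -, hw⟩ | ⟨w, hw, -⟩ | ⟨w, hw, -⟩
      · have : w ∈ {w | G.Adj x w ∧ (E.cfg i).p w = some x} :=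
          ⟨hadj, (hstay w hadj j hij.le le_rfl).1 hw⟩
        rw [lowestSet_eq_none.1 hl] at this
        exact this
      · simp [hpj] at hw
      · simp [hpj] at hw
    | some w =>
      obtain ⟨⟨hadj, hw⟩, -⟩ := lowestSet_eq_some hl
      have hwj := (hstay w hadj j hij.le le_rfl).2 hw
      rw [hl] at hpj
      rcases hj.2.1 with ⟨h, -⟩ | ⟨z, hz, h⟩ | ⟨z, hz, h⟩
      · simp [hpj] at h
      · obtain rfl : w = z := by simpa [hpj] using hz
        exact h ⟨hadj, hmatched w hadj⟩
      · obtain rfl : w = z := by simpa [hpj] using hz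
        exact h hwj
  · refine (cnt_exists (Q := fun w t => (m w ≠ none ∧ w ∈ E.act t) ∧
      ((E.cfg t).p w = some x ∨ (E.cfg (t + 1)).p w = some x)) (fun t h => h) N).trans ?_
    refine Finset.sum_le_sum fun w _ => cnt_or (fun t ht => ?_) N
    exact ht.2.imp (fun h => ⟨ht.1, h⟩) (fun h => ⟨ht.1, h⟩)

theorem sum_cnt_moves (hM : MaxMatchingOn G m) (N : ℕ) :
    ∑ u, cnt (fun i => u ∈ E.act i) N ≤ 746 * Fintype.card V ^ 3 := by
  set n := Fintype.card V with hn
  have hmatched : ∀ w, cnt (fun t => m w ≠ none ∧ w ∈ E.act t) N ≤ 246 * n ^ 2 := by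
    intro w
    cases hw : m w with
    | none => simp [cnt]
    | some v =>
      exact (cnt_le_cnt (fun t h => h.2) N).trans (E.cnt_moves_matched hM hw N)
  have hvertex : ∀ u, cnt (fun i => u ∈ E.act i) N ≤
      cnt (fun t => m u ≠ none ∧ u ∈ E.act t) N + ((6 * n + 1) + (∑ w,
        (cnt (fun t => (m w ≠ none ∧ w ∈ E.act t) ∧ (E.cfg t).p w = some u) N +
        cnt (fun t => (m w ≠ none ∧ w ∈ E.act t) ∧ (E.cfg (t + 1)).p w = some u) N) + 1)) := by
    intro u
    by_cases hu : m u = none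
    · refine le_trans ?_ (Nat.le_add_left _ _)
      refine (cnt_or (Q := E.EndChange u) (R := E.UpdatesP u) (fun t ht => ?_) N).trans
        (Nat.add_le_add (E.cnt_endChange hM hu N) (E.cnt_updatesP hM hu N))
      cases (E.localStep t).single hu with
      | idle hA => contradiction
      | resetEnd hA hp0 he0 hp he => exact Or.inl (by simp [EndChange, he, he0])
      | updateP hA hg hp he => exact Or.inr ⟨hA, hg, hp⟩
      | updateEnd hA w hw hadj hm hpw hne hp he =>
        exact Or.inl (by rw [EndChange, he]; exact hne.symm)
    · exact le_trans (cnt_le_cnt (fun t ht => ⟨hu, ht⟩) N) (Nat.le_add_right _ _)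
  have hptr : ∑ u, ∑ w,
      (cnt (fun t => (m w ≠ none ∧ w ∈ E.act t) ∧ (E.cfg t).p w = some u) N +
        cnt (fun t => (m w ≠ none ∧ w ∈ E.act t) ∧ (E.cfg (t + 1)).p w = some u) N) ≤
      n * (2 * (246 * n ^ 2)) := by
    rw [Finset.sum_comm]
    refine (Finset.sum_le_card_nsmul _ _ (2 * (246 * n ^ 2)) fun w _ => ?_).trans (by simp [hn])
    rw [Finset.sum_add_distrib]
    have h1 := sum_cnt_fiber_le (fun t => m w ≠ none ∧ w ∈ E.act t) (fun t => (E.cfg t).p w) N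
    have h2 := sum_cnt_fiber_le (fun t => m w ≠ none ∧ w ∈ E.act t)
      (fun t => (E.cfg (t + 1)).p w) N
    have h3 := hmatched w
    omega
  have hsum := Finset.sum_le_sum fun u (_ : u ∈ Finset.univ) => hvertex u
  have hsum' := Finset.sum_le_sum fun u (_ : u ∈ Finset.univ) => hmatched u
  simp only [Finset.sum_add_distrib, Finset.sum_const, Finset.card_univ, smul_eq_mul, mul_one,
    ← hn] at hsum hsum' hptr
  rcases Nat.eq_zero_or_pos n with h0 | hpos
  · rw [h0] at hsum hsum' hptr ⊢
    omega
  · have h1 : n ≤ n ^ 3 := Nat.le_self_pow (by norm_num) n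
    have h2 : n ^ 2 ≤ n ^ 3 := Nat.pow_le_pow_right hpos (by norm_num)
    nlinarith

theorem card_moves_le (hM : MaxMatchingOn G m) (T : Finset (ℕ × V))
    (hT : ∀ q ∈ T, q.2 ∈ E.act q.1) : T.card ≤ 746 * Fintype.card V ^ 3 := by
  obtain ⟨N, hN⟩ : ∃ N, ∀ q ∈ T, q.1 < N :=
    ⟨T.sup Prod.fst + 1, fun q hq => Nat.lt_succ_of_le (Finset.le_sup (f := Prod.fst) hq)⟩
  refine le_trans ?_ (E.sum_cnt_moves hM N)
  rw [Finset.card_eq_sum_card_fiberwise (f := Prod.snd) (t := Finset.univ) (by simp)]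
  refine Finset.sum_le_sum fun u _ => ?_
  refine Finset.card_le_card_of_injOn Prod.fst (fun q hq => ?_) (fun q hq q' hq' h => ?_)
  · simp only [Finset.coe_filter, Set.mem_ofPred_eq] at hq
    simp only [Finset.coe_filter, Finset.mem_range, Set.mem_ofPred_eq]
    exact ⟨hN q hq.1, hq.2 ▸ hT q hq.1⟩
  · simp only [Finset.coe_filter, Set.mem_ofPred_eq] at hq hq'
    exact Prod.ext h (hq.2.trans hq'.2.symm)

theorem eventually_idle {K : ℕ} (h : ∀ T : Finset (ℕ × V), (∀ q ∈ T, q.2 ∈ E.act q.1) →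
    T.card ≤ K) : ∃ N : ℕ, ∀ i, N ≤ i → E.act i = ∅ := by
  by_contra hno
  push Not at hno
  have hinf : {i | (E.act i).Nonempty}.Infinite := by
    rw [Set.infinite_iff_exists_gt]
    intro a
    obtain ⟨i, hi, hne⟩ := hno (a + 1)
    exact ⟨i, hne, hi⟩
  obtain ⟨S, hS, hcard⟩ := hinf.exists_subset_card_eq (K + 1)
  obtain ⟨-, -, v₀, -⟩ := hno 0
  have : Nonempty V := ⟨v₀⟩
  choose! f hf using fun i (hi : (E.act i).Nonempty) => hi
  have := h (S.image fun i => (i, f i)) (by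
    intro q hq
    obtain ⟨i, hi, rfl⟩ := Finset.mem_image.1 hq
    exact hf i (hS hi))
  rw [Finset.card_image_of_injective _ (fun i j hij => (Prod.ext_iff.1 hij).1)] at this
  omega

end MMExecution

end Executions

/-- MaxMatch is silent and converges in `O(n³)` moves under the adversarial
distributed daemon: some constant `c > 0` bounds, for every graph, maximal
matching and execution, the total number of moves by `c·n³`, and every
execution eventually makes no further move. -/
theorem stmt6 :
    ∃ c : ℕ, 0 < c ∧
      ∀ (V : Type) [Fintype V] [LinearOrder V] (G : SimpleGraph V)
        (m : V → Option V), MaxMatchingOn G m →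
        ∀ E : MMExecution G m,
          (∀ T : Finset (ℕ × V), (∀ q ∈ T, q.2 ∈ E.act q.1) →
            T.card ≤ c * (Fintype.card V) ^ 3) ∧
          (∃ N : ℕ, ∀ i, N ≤ i → E.act i = ∅) := by
  refine ⟨746, by norm_num, fun V _ _ G m hM E => ?_⟩
  exact ⟨E.card_moves_le hM, E.eventually_idle (E.card_moves_le hM)⟩
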